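/- arXiv:1302.4116 — 2 statements merged into one kernel-verified Lean document; each statement's English description precedes it below -/
import Mathlib

section
/- Let g : [1,∞) → (0,∞) be nonincreasing with g(x) → 0 as x → ∞ and inf_{x ≥ 1} g(x²)/g(x) > 0. Then there exist a holomorphic map φ : 𝔻 → 𝔻, a bounded linear operator T on ℓ² satisfying f_{Ta}(z) = f_a(φ(z)) for all a ∈ ℓ² and z ∈ 𝔻 (i.e. T = C_φ), and constants 0 < c ≤ C such that T is a compact operator and c·g(n) ≤ a_n(T) ≤ C·g(n) for every integer n ≥ 1. -/
open Complex MeasureTheory Filter Set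

noncomputable section

abbrev H2 : Type := lp (fun _ : ℕ => ℂ) 2

noncomputable def fa (a : H2) (z : ℂ) : ℂ := ∑' k : ℕ, a k * z ^ k

noncomputable def approxNum (T : H2 →L[ℂ] H2) (n : ℕ) : ℝ :=
  sInf {c : ℝ | ∃ R : H2 →L[ℂ] H2,
    FiniteDimensional ℂ (LinearMap.range R.toLinearMap) ∧
    Module.finrank ℂ (LinearMap.range R.toLinearMap) ≤ n - 1 ∧ c = ‖T - R‖}


/-- squared `ℓ²` norm of the first `n` coefficients of a polynomial -/
def polyS (n : ℕ) (p : Polynomial ℂ) : ℝ := ∑ k ∈ Finset.range n, ‖p.coeff k‖ ^ 2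

lemma polyS_nonneg (n : ℕ) (p : Polynomial ℂ) : 0 ≤ polyS n p :=
  Finset.sum_nonneg fun _ _ => by positivity

lemma polyS_succ (n : ℕ) (p : Polynomial ℂ) :
    polyS (n + 1) p = polyS n p.divX + ‖p.coeff 0‖ ^ 2 := by
  simp [polyS, Finset.sum_range_succ', Polynomial.coeff_divX]

lemma poly_maj (n : ℕ) : ∀ p : Polynomial ℂ, (∀ k, n ≤ k → p.coeff k = 0) →
    ∃ Q G : Polynomial ℂ, (Q.eval 0).re = polyS n p ∧ (G.eval 0).re ≤ n * polyS n p ∧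
      ∀ x : ℂ, ‖x‖ ≤ 1 → ‖p.eval x‖ ^ 2 ≤ (Q.eval x).re ∧
        (Q.eval x).re ≤ ‖p.eval x‖ ^ 2 + (1 - ‖x‖ ^ 2) * (G.eval x).re ∧ 0 ≤ (G.eval x).re := by
  induction n with
  | zero =>
    intro p hp
    have : p = 0 := by ext k; simpa using hp k (Nat.zero_le _)
    subst this
    exact ⟨0, 0, by simp [polyS], by simp [polyS], fun x hx => by simp⟩
  | succ n ih =>
    intro p hp
    obtain ⟨Q, G, hQ0, hG0, h⟩ := ih p.divX (fun k hk => by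
      rw [Polynomial.coeff_divX]; exact hp _ (by omega))
    set a := p.coeff 0 with ha
    have key : ∀ x : ℂ, p.eval x = x * p.divX.eval x + a := by
      intro x
      have := congrArg (Polynomial.eval x) (Polynomial.X_mul_divX_add p)
      rw [Polynomial.eval_add, Polynomial.eval_mul, Polynomial.eval_X, Polynomial.eval_C] at this
      exact this.symm
    refine ⟨Q + Polynomial.C (2 * (starRingEnd ℂ) a) * p - Polynomial.C ((‖a‖ ^ 2 : ℝ) : ℂ),
      G + Q, ?_, ?_, ?_⟩
    · rw [polyS_succ]
      simp only [Polynomial.eval_sub, Polynomial.eval_add, Polynomial.eval_mul, Polynomial.eval_C,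
        Complex.sub_re, Complex.add_re, hQ0, key 0, zero_mul, zero_add, Complex.ofReal_re]
      rw [show (2 * (starRingEnd ℂ) a * a) = ((2 * ‖a‖ ^ 2 : ℝ) : ℂ) by
        rw [mul_assoc, mul_comm _ a, Complex.mul_conj, Complex.normSq_eq_norm_sq]; push_cast; ring]
      rw [Complex.ofReal_re]; ring
    · rw [polyS_succ]
      simp only [Polynomial.eval_add, Complex.add_re, hQ0]
      have := polyS_nonneg n p.divX
      push_cast
      nlinarith [sq_nonneg ‖a‖, mul_nonneg (Nat.cast_nonneg (α := ℝ) n) (sq_nonneg ‖a‖)]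
    · intro x hx
      obtain ⟨h1, h2, h3⟩ := h x hx
      have e1 : ‖p.eval x‖ ^ 2 = ‖x‖ ^ 2 * ‖p.divX.eval x‖ ^ 2
          + 2 * ((starRingEnd ℂ) a * (x * p.divX.eval x)).re + ‖a‖ ^ 2 := by
        rw [key x, ← Complex.normSq_eq_norm_sq, ← Complex.normSq_eq_norm_sq,
          ← Complex.normSq_eq_norm_sq, ← Complex.normSq_eq_norm_sq, Complex.normSq_add,
          Complex.normSq_mul, mul_comm ((starRingEnd ℂ) a)]
        ring
      have e2 : ((Q + Polynomial.C (2 * (starRingEnd ℂ) a) * p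
          - Polynomial.C ((‖a‖ ^ 2 : ℝ) : ℂ)).eval x).re
          = (Q.eval x).re + 2 * ((starRingEnd ℂ) a * (x * p.divX.eval x)).re + ‖a‖ ^ 2 := by
        simp only [Polynomial.eval_sub, Polynomial.eval_add, Polynomial.eval_mul,
          Polynomial.eval_C, Complex.sub_re, Complex.add_re, Complex.ofReal_re]
        rw [show 2 * (starRingEnd ℂ) a * p.eval x
          = ((2 * ‖a‖ ^ 2 : ℝ) : ℂ) + (2 : ℝ) * ((starRingEnd ℂ) a * (x * p.divX.eval x)) by
            rw [key x]
            have : (starRingEnd ℂ) a * a = ((‖a‖ ^ 2 : ℝ) : ℂ) := by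
              rw [mul_comm, Complex.mul_conj, Complex.normSq_eq_norm_sq]
            push_cast at this ⊢
            linear_combination 2 * this]
        rw [Complex.add_re, Complex.ofReal_re, Complex.re_ofReal_mul]; ring
      have hx2 : ‖x‖ ^ 2 ≤ 1 := by nlinarith [norm_nonneg x]
      have hq := sq_nonneg ‖p.divX.eval x‖
      rw [e1, e2]
      simp only [Polynomial.eval_add, Complex.add_re]
      refine ⟨by nlinarith, by nlinarith, by nlinarith⟩

lemma harnack (Q : Polynomial ℂ) (hQ : ∀ x : ℂ, ‖x‖ ≤ 1 → 0 ≤ (Q.eval x).re) (x : ℂ)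
    (hx : ‖x‖ ≤ 1 / 3) :
    (Q.eval 0).re / 2 ≤ (Q.eval x).re ∧ (Q.eval x).re ≤ 2 * (Q.eval 0).re := by
  have hd : DiffContOnCl ℂ (fun z => Q.eval z) (Metric.ball 0 1) :=
    (Polynomial.differentiable Q).diffContOnCl
  have hx1 : x ∈ Metric.ball (0:ℂ) 1 := by simp; linarith
  have h1 := hd.circleAverage_re_herglotzRieszKernel_smul' hx1
  have h0 := hd.circleAverage_re_herglotzRieszKernel_smul' (w := 0) (by simp)
  have hc : Continuous (fun z : ℂ => Q.eval z) := Q.continuous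
  have hne : ∀ z ∈ Metric.sphere (0:ℂ) 1, z - x ≠ 0 := by
    intro z hz h
    have : z = x := sub_eq_zero.1 h
    rw [this] at hz; simp at hz; linarith
  have i1 : CircleIntegrable (fun z : ℂ => (((z - 0 + (x - 0)) / (z - 0 - (x - 0))).re) • Q.eval z) 0 1 := by
    apply ContinuousOn.circleIntegrable zero_le_one
    simp only [sub_zero]
    refine ContinuousOn.fun_smul ?_ hc.continuousOn
    refine Complex.continuous_re.comp_continuousOn ?_
    exact ContinuousOn.div (by fun_prop) (by fun_prop) hne
  have r1 := Complex.reCLM.circleAverage_comp_comm i1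
  rw [h1] at r1
  have i0 : CircleIntegrable (fun z : ℂ => Q.eval z) 0 1 :=
    hc.continuousOn.circleIntegrable zero_le_one
  have h0' : Real.circleAverage (fun z : ℂ => Q.eval z) 0 1 = Q.eval 0 := by
    have := DiffContOnCl.circleAverage (f := fun z => Q.eval z) (c := 0) (R := 1) (by simpa using hd)
    simpa using this
  have r0 := Complex.reCLM.circleAverage_comp_comm i0
  rw [h0'] at r0
  have ir0 : CircleIntegrable (fun z : ℂ => (Q.eval z).re) 0 1 :=
    (Complex.continuous_re.comp hc).continuousOn.circleIntegrable zero_le_one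
  have ir1 : CircleIntegrable (Complex.reCLM ∘ (fun z : ℂ => (((z - 0 + (x - 0)) / (z - 0 - (x - 0))).re) • Q.eval z)) 0 1 := by
    apply ContinuousOn.circleIntegrable zero_le_one
    refine Complex.reCLM.continuous.comp_continuousOn ?_
    simp only [sub_zero]
    refine ContinuousOn.fun_smul ?_ hc.continuousOn
    refine Complex.continuous_re.comp_continuousOn ?_
    exact ContinuousOn.div (by fun_prop) (by fun_prop) hne
  have hb : ∀ z ∈ Metric.sphere (0:ℂ) 1, 1/2 ≤ ((z - 0 + (x - 0)) / (z - 0 - (x - 0))).re ∧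
      ((z - 0 + (x - 0)) / (z - 0 - (x - 0))).re ≤ 2 := by
    intro z hz
    have l := le_re_herglotzRieszKernel hz hx1
    have u := re_herglotzRieszKernel_le hz hx1
    rw [sub_zero x] at l u
    have hn := norm_nonneg x
    refine ⟨le_trans ?_ (by simpa using l), le_trans (by simpa using u) ?_⟩
    · rw [div_le_div_iff₀ (by norm_num) (by linarith)]; linarith
    · rw [div_le_iff₀ (by linarith)]; linarith
  constructor
  · have := Real.circleAverage_mono (f₁ := (1/2 : ℝ) • (fun z : ℂ => (Q.eval z).re)) (ir0.const_smul) ir1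
      (fun z hz => by
        rw [abs_one] at hz
        have h := (hb z hz).1
        have hq := hQ z (by simp at hz; exact hz.le)
        simp only [Pi.smul_apply, smul_eq_mul, Function.comp, Complex.reCLM_apply, Complex.smul_re]
        exact mul_le_mul_of_nonneg_right h hq)
    rw [Real.circleAverage_smul] at this
    have r0' : Real.circleAverage (fun z : ℂ => (Q.eval z).re) 0 1 = (Q.eval 0).re := r0
    rw [r0', r1] at this
    simp only [smul_eq_mul, Complex.reCLM_apply] at this
    linarith
  · have := Real.circleAverage_mono (f₂ := (2 : ℝ) • (fun z : ℂ => (Q.eval z).re)) ir1 (ir0.const_smul)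
      (fun z hz => by
        rw [abs_one] at hz
        have h := (hb z hz).2
        have hq := hQ z (by simp at hz; exact hz.le)
        simp only [Pi.smul_apply, smul_eq_mul, Function.comp, Complex.reCLM_apply, Complex.smul_re]
        exact mul_le_mul_of_nonneg_right h hq)
    rw [Real.circleAverage_smul] at this
    have r0' : Real.circleAverage (fun z : ℂ => (Q.eval z).re) 0 1 = (Q.eval 0).re := r0
    rw [r0', r1] at this
    simp only [smul_eq_mul, Complex.reCLM_apply] at this
    linarith


/-- closed disc without the point `1` -/
def DD : Set ℂ := Metric.closedBall 0 1 \ {1}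

lemma circleMap_mem_DD {t : ℝ} (ht : t ∈ Set.Ioo 0 (2 * Real.pi)) : circleMap 0 1 t ∈ DD := by
  refine ⟨by simp, ?_⟩
  intro h
  have h1 : circleMap 0 1 t = 1 := h
  simp only [circleMap, ofReal_one, one_mul, zero_add] at h1
  have := congrArg Complex.re h1
  rw [Complex.exp_ofReal_mul_I_re, Complex.one_re] at this
  obtain ⟨k, hk⟩ := (Real.cos_eq_one_iff t).1 this
  have hp := Real.pi_pos
  have h0 : (0:ℝ) < k := by
    have := ht.1; rw [← hk] at this
    by_contra hcon; push Not at hcon; nlinarith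
  have h2 : (k:ℝ) < 1 := by
    have := ht.2; rw [← hk] at this
    by_contra hcon; push Not at hcon; nlinarith
  have a1 : 0 < k := by exact_mod_cast h0
  have a2 : k < 1 := by exact_mod_cast h2
  omega

lemma smul_mem_DD {z : ℂ} (hz : ‖z‖ ≤ 1) {r : ℝ} (hr : r ∈ Set.Ico (0:ℝ) 1) : (r:ℂ) * z ∈ Metric.ball (0:ℂ) 1 := by
  simp only [Metric.mem_ball, dist_zero_right, norm_mul, Complex.norm_real, Real.norm_eq_abs, abs_of_nonneg hr.1]
  have := hr.2; have := hr.1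
  nlinarith [norm_nonneg z]

lemma ball_sub_DD : Metric.ball (0:ℂ) 1 ⊆ DD := by
  intro z hz
  refine ⟨Metric.ball_subset_closedBall hz, ?_⟩
  rintro rfl
  simp at hz

section bdry
variable {E : Type*} [NormedAddCommGroup E] [NormedSpace ℝ E]

lemma bdry_integrable {F : ℂ → E} {M : ℝ} (hF : ContinuousOn F DD) (hM : ∀ z ∈ DD, ‖F z‖ ≤ M) :
    CircleIntegrable F 0 1 := by
  unfold CircleIntegrable
  rw [intervalIntegrable_iff_integrableOn_Ioo_of_le Real.two_pi_pos.le]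
  refine Integrable.of_bound ?_ M ?_
  · refine ContinuousOn.aestronglyMeasurable ?_ measurableSet_Ioo
    exact hF.comp (continuous_circleMap 0 1).continuousOn (fun t ht => circleMap_mem_DD ht)
  · filter_upwards [ae_restrict_mem measurableSet_Ioo] with t ht
    exact hM _ (circleMap_mem_DD ht)

lemma bdry_tendsto {F : ℂ → E} {M : ℝ} (hF : ContinuousOn F DD) (hM : ∀ z ∈ DD, ‖F z‖ ≤ M)
    {K : ℂ → ℝ} (hK : ContinuousOn K (Metric.sphere 0 1)) :
    Tendsto (fun r : ℝ => Real.circleAverage (fun z => K z • F (r * z)) 0 1) (nhdsWithin 1 (Set.Iio 1))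
      (nhds (Real.circleAverage (fun z => K z • F z) 0 1)) := by
  unfold Real.circleAverage
  refine Tendsto.const_smul ?_ _
  obtain ⟨B, hB⟩ := (isCompact_sphere (0:ℂ) 1).exists_bound_of_continuousOn hK
  have hmem : ∀ᶠ r : ℝ in nhdsWithin 1 (Set.Iio 1), r ∈ Set.Ico (0:ℝ) 1 := by
    filter_upwards [self_mem_nhdsWithin, mem_nhdsWithin_of_mem_nhds (lt_mem_nhds (zero_lt_one))] with r h1 h2
    exact ⟨h2.le, h1⟩
  have hKc : Continuous fun t : ℝ => K (circleMap 0 1 t) :=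
    hK.comp_continuous (continuous_circleMap 0 1) (fun t => by simp)
  refine intervalIntegral.tendsto_integral_filter_of_dominated_convergence (fun _ => B * M) ?_ ?_ ?_ ?_
  · filter_upwards [hmem] with r hr
    refine (hKc.smul ?_).aestronglyMeasurable
    refine hF.comp_continuous (by fun_prop) (fun t => ball_sub_DD (smul_mem_DD (by simp) hr))
  · filter_upwards [hmem] with r hr
    refine Filter.Eventually.of_forall fun t _ => ?_
    rw [norm_smul]
    have h1 := hB (circleMap 0 1 t) (by simp)
    have h2 := hM _ (ball_sub_DD (smul_mem_DD (z := circleMap 0 1 t) (by simp) hr))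
    exact mul_le_mul h1 h2 (norm_nonneg _) (le_trans (norm_nonneg _) h1)
  · simp
  · have : ∀ᵐ t : ℝ, t ≠ 2 * Real.pi := by
      simp [ae_iff, measure_singleton]
    filter_upwards [this] with t ht htm
    rw [Set.uIoc_of_le Real.two_pi_pos.le] at htm
    have hz := circleMap_mem_DD ⟨htm.1, lt_of_le_of_ne htm.2 ht⟩
    refine Tendsto.const_smul ?_ _
    have hcont := hF _ hz
    refine hcont.tendsto.comp ?_
    refine tendsto_nhdsWithin_iff.2 ⟨?_, ?_⟩
    · have : Continuous fun r : ℝ => (r:ℂ) * circleMap 0 1 t := by fun_prop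
      have := (this.tendsto 1).mono_left (nhdsWithin_le_nhds (s := Set.Iio 1))
      simpa using this
    · filter_upwards [hmem] with r hr
      exact ball_sub_DD (smul_mem_DD (by simp) hr)

end bdry

lemma circleAverage_mono' {f g : ℂ → ℝ} (hf : CircleIntegrable f 0 1) (hg : CircleIntegrable g 0 1)
    (h : ∀ z ∈ DD, ‖z‖ = 1 → f z ≤ g z) :
    Real.circleAverage f 0 1 ≤ Real.circleAverage g 0 1 := by
  apply (mul_le_mul_iff_of_pos_left (by simp [Real.pi_pos])).2
  apply intervalIntegral.integral_mono_on_of_le_Ioo (le_of_lt Real.two_pi_pos) hf hg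
  exact fun x hx ↦ h _ (circleMap_mem_DD hx) (by simp)

/-- Poisson formula for bounded functions, continuous up to the boundary except at `1`. -/
lemma bdry_poisson {F : ℂ → ℂ} {M : ℝ} (hF : ContinuousOn F DD) (hM : ∀ z ∈ DD, ‖F z‖ ≤ M)
    (hd : DifferentiableOn ℂ F (Metric.ball 0 1)) {w : ℂ} (hw : w ∈ Metric.ball (0:ℂ) 1) :
    Real.circleAverage (fun z => poissonKernel 0 w z * (F z).re) 0 1 = (F w).re := by
  have hK : ContinuousOn (poissonKernel 0 w) (Metric.sphere 0 1) := by
    rw [poissonKernel_eq_re_herglotzRieszKernel]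
    exact Complex.continuous_re.comp_continuousOn
      (by simpa using continuousOn_herglotzRieszKernel_sphere hw)
  have h1 := bdry_tendsto hF hM hK
  have hmem : ∀ᶠ r : ℝ in nhdsWithin 1 (Set.Iio 1), r ∈ Set.Ico (0:ℝ) 1 := by
    filter_upwards [self_mem_nhdsWithin, mem_nhdsWithin_of_mem_nhds (lt_mem_nhds (zero_lt_one))] with r h1 h2
    exact ⟨h2.le, h1⟩
  have h2 : Tendsto (fun r : ℝ => F (r * w)) (nhdsWithin 1 (Set.Iio 1))
      (nhds (Real.circleAverage (fun z => poissonKernel 0 w z • F z) 0 1)) := by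
    refine h1.congr' ?_
    filter_upwards [hmem] with r hr
    have : DiffContOnCl ℂ (fun z => F (r * z)) (Metric.ball 0 1) := by
      apply DifferentiableOn.diffContOnCl
      rw [closure_ball _ one_ne_zero]
      refine hd.comp (by fun_prop) ?_
      intro z hz
      exact smul_mem_DD (by simpa using hz) hr
    exact this.circleAverage_poissonKernel_smul hw
  have h3 : Tendsto (fun r : ℝ => F (r * w)) (nhdsWithin 1 (Set.Iio 1)) (nhds (F w)) := by
    have hc : ContinuousAt F w := (hd.continuousOn).continuousAt (Metric.isOpen_ball.mem_nhds hw)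
    refine hc.tendsto.comp ?_
    have : Continuous fun r : ℝ => (r:ℂ) * w := by fun_prop
    have := (this.tendsto 1).mono_left (nhdsWithin_le_nhds (s := Set.Iio 1))
    simpa using this
  have h4 := tendsto_nhds_unique h2 h3
  have hi : CircleIntegrable (fun z => poissonKernel 0 w z • F z) 0 1 := by
    have := (bdry_integrable hF hM).continuousOn_smul (g := fun z => ((poissonKernel 0 w z : ℝ) : ℂ))
      (by rw [abs_one]; exact Complex.continuous_ofReal.comp_continuousOn hK)
    exact this
  have := Complex.reCLM.circleAverage_comp_comm hi
  rw [h4] at this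
  simpa [Function.comp_def] using this

lemma poisson_integrable {f : ℂ → ℝ} (hf : CircleIntegrable f 0 1) {w : ℂ} (hw : w ∈ Metric.ball (0:ℂ) 1) :
    CircleIntegrable (fun z => poissonKernel 0 w z * f z) 0 1 := by
  have hK : ContinuousOn (poissonKernel 0 w) (Metric.sphere 0 1) := by
    rw [poissonKernel_eq_re_herglotzRieszKernel]
    exact Complex.continuous_re.comp_continuousOn
      (by simpa using continuousOn_herglotzRieszKernel_sphere hw)
  exact hf.continuousOn_mul (by simpa using hK)



def csq (w : ℂ) : ℂ := w ^ (2⁻¹ : ℂ)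

lemma csq_sq (w : ℂ) : csq w ^ 2 = w := Complex.cpow_ofNat_inv_pow w 2

lemma csq_re (w : ℂ) : 0 ≤ (csq w).re := by
  rw [csq, Complex.cpow_inv_two_re]; positivity

lemma csq_im {w : ℂ} (hw : 0 ≤ w.re) : |(csq w).im| ≤ (csq w).re := by
  have h := congrArg Complex.re (csq_sq w)
  rw [pow_two, Complex.mul_re] at h
  apply abs_le_of_sq_le_sq _ (csq_re w)
  nlinarith

def Ar (ζ : ℂ) : ℂ := csq (ζ + I) * csq (ζ - I)

def Af (ζ : ℂ) : ℂ := Ar ζ - ζ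

lemma Ar_sq (ζ : ℂ) : Ar ζ ^ 2 = 1 + ζ ^ 2 := by
  rw [Ar, mul_pow, csq_sq, csq_sq]
  ring_nf
  simp [add_comm]

lemma Ar_re {ζ : ℂ} (h : 0 ≤ ζ.re) : 0 ≤ (Ar ζ).re := by
  have h1 := abs_le.1 (csq_im (w := ζ + I) (by simpa using h))
  have h2 := abs_le.1 (csq_im (w := ζ - I) (by simpa using h))
  rw [Ar, Complex.mul_re]
  nlinarith

lemma Af_prop {ζ : ℂ} (h : 0 ≤ ζ.re) : 0 ≤ (Af ζ).re ∧ ‖Af ζ‖ ≤ 1 := by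
  set B := Ar ζ + ζ with hB
  have hAB : Af ζ * B = 1 := by
    have := Ar_sq ζ
    rw [hB, Af]; linear_combination this
  have hBre : 0 ≤ B.re := by
    have := Ar_re h
    rw [hB, Complex.add_re]; linarith
  constructor
  · have e : Af ζ = (‖Af ζ‖ ^ 2 : ℝ) * (starRingEnd ℂ) B := by
      have h1 : (starRingEnd ℂ) (Af ζ) * (starRingEnd ℂ) B = 1 := by
        rw [← map_mul, hAB, map_one]
      have h2 : ((‖Af ζ‖ ^ 2 : ℝ) : ℂ) = Af ζ * (starRingEnd ℂ) (Af ζ) := by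
        rw [Complex.mul_conj, Complex.normSq_eq_norm_sq]
      rw [h2, mul_assoc, h1, mul_one]
    rw [e, Complex.re_ofReal_mul, Complex.conj_re]
    positivity
  · have h1 := abs_le.1 (csq_im (w := ζ + I) (by simpa using h))
    have h2 := abs_le.1 (csq_im (w := ζ - I) (by simpa using h))
    have e1 := csq_sq (ζ + I)
    have e2 := csq_sq (ζ - I)
    set a := csq (ζ + I)
    set b := csq (ζ - I)
    have eA : Af ζ = - (a - b) ^ 2 / 2 := by
      rw [Af, Ar]; linear_combination (1 / 2 : ℂ) * e1 + (1 / 2 : ℂ) * e2 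
    have eB : B = (a + b) ^ 2 / 2 := by
      rw [hB, Ar]; linear_combination (-1 / 2 : ℂ) * e1 + (-1 / 2 : ℂ) * e2 
    have hle : ‖a - b‖ ^ 2 ≤ ‖a + b‖ ^ 2 := by
      rw [← Complex.normSq_eq_norm_sq, ← Complex.normSq_eq_norm_sq, Complex.normSq_apply, Complex.normSq_apply]
      simp only [Complex.sub_re, Complex.sub_im, Complex.add_re, Complex.add_im]
      nlinarith
    have hle2 : ‖Af ζ‖ ≤ ‖B‖ := by
      rw [eA, eB]; simp only [norm_div, norm_neg, norm_pow]; gcongr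
    have : ‖Af ζ‖ * ‖B‖ = 1 := by rw [← norm_mul, hAB, norm_one]
    nlinarith [norm_nonneg (Af ζ)]

lemma csq_cont {w : ℂ} (hw : 0 ≤ w.re) : ContinuousAt csq w :=
  continuousAt_cpow_const_of_re_pos (Or.inl hw) (by norm_num)

lemma csq_diff {w : ℂ} (hw : 0 < w.re) : DifferentiableAt ℂ csq w :=
  DifferentiableAt.cpow_const differentiableAt_id (Or.inl hw)

lemma Af_cont {ζ : ℂ} (h : 0 ≤ ζ.re) : ContinuousAt Af ζ := by
  have h1 : ContinuousAt (fun ζ => csq (ζ + I)) ζ :=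
    ContinuousAt.comp (f := fun ζ => ζ + I) (csq_cont (by simpa using h)) (by fun_prop)
  have h2 : ContinuousAt (fun ζ => csq (ζ - I)) ζ :=
    ContinuousAt.comp (f := fun ζ => ζ - I) (csq_cont (by simpa using h)) (by fun_prop)
  exact (h1.mul h2).sub continuousAt_id

lemma Af_diff {ζ : ℂ} (h : 0 < ζ.re) : DifferentiableAt ℂ Af ζ := by
  have h1 : DifferentiableAt ℂ (fun ζ => csq (ζ + I)) ζ :=
    DifferentiableAt.comp (f := fun ζ => ζ + I) ζ (csq_diff (by simpa using h)) (by fun_prop)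
  have h2 : DifferentiableAt ℂ (fun ζ => csq (ζ - I)) ζ :=
    DifferentiableAt.comp (f := fun ζ => ζ - I) ζ (csq_diff (by simpa using h)) (by fun_prop)
  exact (h1.mul h2).sub differentiableAt_id

lemma Af_far {ζ : ℂ} (h : ζ.re = 0) (h1 : 1 ≤ ‖ζ‖) : (Af ζ).re = 0 := by
  have e := Ar_sq ζ
  have hz : ζ = ζ.im * I := by apply Complex.ext <;> simp [h]
  have hn : 1 ≤ ζ.im ^ 2 := by
    have : ‖ζ‖ = |ζ.im| := by rw [hz]; simp
    rw [this] at h1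
    nlinarith [sq_abs ζ.im]
  have er := congrArg Complex.re e
  have ei := congrArg Complex.im e
  simp [pow_two, h] at er ei
  rw [Af, Complex.sub_re, h, sub_zero]
  by_contra hne
  have : (Ar ζ).im = 0 := by
    have : (Ar ζ).re * (Ar ζ).im = 0 := by linarith
    simpa [hne] using this
  rw [this] at er
  have : 0 < (Ar ζ).re * (Ar ζ).re := mul_self_pos.2 hne
  nlinarith

lemma Af_near {ζ : ℂ} (h : 0 ≤ ζ.re) (h1 : ‖ζ‖ ≤ 1 / 2) : 1 / 4 ≤ (Af ζ).re := by
  have e := Ar_sq ζ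
  have hs := Ar_re h
  have e2 : (Ar ζ - 1) * (Ar ζ + 1) = ζ ^ 2 := by linear_combination e
  have h2 : 1 ≤ ‖Ar ζ + 1‖ := by
    refine le_trans ?_ (Complex.re_le_norm _)
    simpa using hs
  have h3 : ‖Ar ζ - 1‖ * ‖Ar ζ + 1‖ = ‖ζ‖ ^ 2 := by rw [← norm_mul, e2, norm_pow]
  have h4 : ‖Ar ζ - 1‖ ≤ 1 / 4 := by nlinarith [norm_nonneg ζ, norm_nonneg (Ar ζ - 1)]
  have h5 := (abs_le.1 (Complex.abs_re_le_norm (Ar ζ - 1))).1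
  have h6 := Complex.re_le_norm ζ
  rw [Complex.sub_re, Complex.one_re] at h5
  rw [Af, Complex.sub_re]
  linarith

/-- Cayley transform -/
def cay (z : ℂ) : ℂ := (1 + z) / (1 - z)

lemma DD_ne {z : ℂ} (hz : z ∈ DD) : 1 - z ≠ 0 := fun h => hz.2 (by
  have : z = 1 := by linear_combination -h
  simpa using this)

lemma DD_norm {z : ℂ} (hz : z ∈ DD) : ‖z‖ ≤ 1 := by simpa using hz.1

lemma cay_re {z : ℂ} : (cay z).re = (1 - ‖z‖ ^ 2) / ‖1 - z‖ ^ 2 := by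
  rw [← Complex.normSq_eq_norm_sq, ← Complex.normSq_eq_norm_sq, cay, Complex.div_re, ← add_div]
  congr 1
  simp [Complex.normSq_apply]; ring

lemma cay_re_nonneg {z : ℂ} (hz : z ∈ DD) : 0 ≤ (cay z).re := by
  rw [cay_re]
  have := DD_norm hz
  have : ‖z‖ ^ 2 ≤ 1 := by nlinarith [norm_nonneg z]
  apply div_nonneg <;> [linarith; positivity]

lemma cay_re_pos {z : ℂ} (hz : z ∈ Metric.ball (0:ℂ) 1) : 0 < (cay z).re := by
  rw [cay_re]
  have h1 := DD_ne (ball_sub_DD hz)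
  have : ‖z‖ < 1 := by simpa using hz
  have : ‖z‖ ^ 2 < 1 := by nlinarith [norm_nonneg z]
  have : 0 < ‖1 - z‖ := norm_pos_iff.2 h1
  apply div_pos <;> [linarith; positivity]

lemma cay_re_zero {z : ℂ} (hz : ‖z‖ = 1) : (cay z).re = 0 := by
  rw [cay_re, hz]; simp

lemma cay_diff {z : ℂ} (hz : z ∈ DD) : DifferentiableAt ℂ cay z := by
  unfold cay
  have := DD_ne hz
  fun_prop (disch := assumption)

/-- the symbol -/
def phiE (d R : ℕ → ℝ) (z : ℂ) : ℂ := ∑' i, (d i : ℂ) * Af (cay z / (R i : ℂ))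

def phi (d R : ℕ → ℝ) (z : ℂ) : ℂ := Complex.exp (-(2 * cay z + phiE d R z))

structure Adm (d R : ℕ → ℝ) : Prop where
  d0 : ∀ i, 0 ≤ d i
  ds : Summable d
  R4 : ∀ i, 4 ≤ R i
  Rm : Monotone R

namespace Adm

lemma Rpos {d R : ℕ → ℝ} (A : Adm d R) (i : ℕ) : 0 < R i := by linarith [A.R4 i]

lemma arg_re {d R : ℕ → ℝ} (A : Adm d R) {z : ℂ} (hz : z ∈ DD) (i : ℕ) : 0 ≤ (cay z / (R i : ℂ)).re := by
  rw [Complex.div_ofReal_re]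
  exact div_nonneg (cay_re_nonneg hz) (A.Rpos i).le

lemma term_le {d R : ℕ → ℝ} (A : Adm d R) {z : ℂ} (hz : z ∈ DD) (i : ℕ) : ‖(d i : ℂ) * Af (cay z / (R i : ℂ))‖ ≤ d i := by
  rw [norm_mul, Complex.norm_real, Real.norm_eq_abs, abs_of_nonneg (A.d0 i)]
  exact mul_le_of_le_one_right (A.d0 i) (Af_prop (A.arg_re hz i)).2

lemma phiE_cont {d R : ℕ → ℝ} (A : Adm d R) : ContinuousOn (phiE d R) DD := by
  refine continuousOn_tsum (fun i => ?_) A.ds (fun i x hx => A.term_le hx i)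
  intro z hz
  have h1 : ContinuousAt (fun z => Af (cay z / (R i : ℂ))) z :=
    ContinuousAt.comp (f := fun z => cay z / (R i : ℂ)) (Af_cont (A.arg_re hz i)) ((cay_diff hz).continuousAt.div_const _)
  exact (continuousAt_const.mul h1).continuousWithinAt

lemma phiE_diff {d R : ℕ → ℝ} (A : Adm d R) : DifferentiableOn ℂ (phiE d R) (Metric.ball 0 1) := by
  refine differentiableOn_tsum_of_summable_norm A.ds (fun i => ?_) Metric.isOpen_ball
    (fun i x hx => A.term_le (ball_sub_DD hx) i)
  intro z hz
  have hp : 0 < (cay z / (R i : ℂ)).re := by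
    rw [Complex.div_ofReal_re]; exact div_pos (cay_re_pos hz) (A.Rpos i)
  have h1 : DifferentiableAt ℂ (fun z => Af (cay z / (R i : ℂ))) z :=
    DifferentiableAt.comp (f := fun z => cay z / (R i : ℂ)) z (Af_diff hp) ((cay_diff (ball_sub_DD hz)).div_const _)
  exact (h1.const_mul _).differentiableWithinAt

lemma phi_cont {d R : ℕ → ℝ} (A : Adm d R) : ContinuousOn (phi d R) DD := by
  have : ContinuousOn cay DD := fun z hz => (cay_diff hz).continuousAt.continuousWithinAt
  have := A.phiE_cont
  unfold phi
  fun_prop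

lemma phi_diff {d R : ℕ → ℝ} (A : Adm d R) : DifferentiableOn ℂ (phi d R) (Metric.ball 0 1) := by
  have : DifferentiableOn ℂ cay (Metric.ball 0 1) :=
    fun z hz => (cay_diff (ball_sub_DD hz)).differentiableWithinAt
  have := A.phiE_diff
  unfold phi
  fun_prop

lemma sm {d R : ℕ → ℝ} (A : Adm d R) {z : ℂ} (hz : z ∈ DD) : Summable fun i => (d i : ℂ) * Af (cay z / (R i : ℂ)) :=
  Summable.of_norm_bounded A.ds (fun i => A.term_le hz i)

lemma phiE_re {d R : ℕ → ℝ} (A : Adm d R) {z : ℂ} (hz : z ∈ DD) : HasSum (fun i => d i * (Af (cay z / (R i : ℂ))).re) (phiE d R z).re := by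
  have := Complex.hasSum_re (A.sm hz).hasSum
  simp only [Complex.re_ofReal_mul] at this
  exact this

lemma phiE_re_ge {d R : ℕ → ℝ} (A : Adm d R) {z : ℂ} (hz : z ∈ DD) (i : ℕ) : d i * (Af (cay z / (R i : ℂ))).re ≤ (phiE d R z).re :=
  le_hasSum (A.phiE_re hz) i (fun k _ => mul_nonneg (A.d0 k) (Af_prop (A.arg_re hz k)).1)

lemma phiE_re_nonneg {d R : ℕ → ℝ} (A : Adm d R) {z : ℂ} (hz : z ∈ DD) : 0 ≤ (phiE d R z).re :=
  (mul_nonneg (A.d0 0) (Af_prop (A.arg_re hz 0)).1).trans (A.phiE_re_ge hz 0)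

lemma phi_norm {d R : ℕ → ℝ} (z : ℂ) : ‖phi d R z‖ = Real.exp (-(2 * (cay z).re + (phiE d R z).re)) := by
  rw [phi, Complex.norm_exp]; simp

lemma phi_le {d R : ℕ → ℝ} (A : Adm d R) {z : ℂ} (hz : z ∈ DD) : ‖phi d R z‖ ≤ Real.exp (-(2 * (cay z).re)) := by
  rw [phi_norm]
  apply Real.exp_le_exp.2
  linarith [A.phiE_re_nonneg hz]

lemma phi_le_one {d R : ℕ → ℝ} (A : Adm d R) {z : ℂ} (hz : z ∈ DD) : ‖phi d R z‖ ≤ 1 := by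
  refine (A.phi_le hz).trans (Real.exp_le_one_iff.2 ?_)
  linarith [cay_re_nonneg hz]

lemma phi_lt_one {d R : ℕ → ℝ} (A : Adm d R) {z : ℂ} (hz : z ∈ Metric.ball (0:ℂ) 1) : ‖phi d R z‖ < 1 := by
  refine (A.phi_le (ball_sub_DD hz)).trans_lt (Real.exp_lt_one_iff.2 ?_)
  linarith [cay_re_pos hz]

lemma phi_near {d R : ℕ → ℝ} (A : Adm d R) {z : ℂ} (hz : z ∈ DD) (h1 : ‖z‖ = 1) {j : ℕ} (hj : ‖cay z‖ ≤ R j / 2) :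
    ‖phi d R z‖ ≤ Real.exp (-(d j / 4)) := by
  rw [phi_norm, cay_re_zero h1]
  apply Real.exp_le_exp.2
  have h2 : ‖cay z / (R j : ℂ)‖ ≤ 1 / 2 := by
    rw [norm_div, Complex.norm_real, Real.norm_eq_abs, abs_of_pos (A.Rpos j), div_le_iff₀ (A.Rpos j)]
    linarith
  have := Af_near (A.arg_re hz j) h2
  have := A.phiE_re_ge hz j
  nlinarith [A.d0 j]

lemma phi_far {d R : ℕ → ℝ} (A : Adm d R) {z : ℂ} (hz : z ∈ DD) (h1 : ‖z‖ = 1) {j : ℕ} (hj : R j ≤ ‖cay z‖) :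
    1 - ‖phi d R z‖ ^ 2 ≤ 2 * ∑' i, d (i + (j + 1)) := by
  have hs := A.phiE_re hz
  have e : (phiE d R z).re ≤ ∑' i, d (i + (j + 1)) := by
    have hz0 : ∑ i ∈ Finset.range (j+1), d i * (Af (cay z / (R i : ℂ))).re = 0 := by
      refine Finset.sum_eq_zero ?_
      intro i hi
      have hi : i ≤ j := by simp at hi; omega
      rw [Af_far, mul_zero]
      · rw [Complex.div_ofReal_re, cay_re_zero h1, zero_div]
      · rw [norm_div, Complex.norm_real, Real.norm_eq_abs, abs_of_pos (A.Rpos i), le_div_iff₀ (A.Rpos i)]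
        linarith [A.Rm hi]
    rw [← hs.tsum_eq, ← hs.summable.sum_add_tsum_nat_add (j + 1), hz0, zero_add]
    have t1 := (summable_nat_add_iff (f := fun i => d i * (Af (cay z / (R i : ℂ))).re) (j+1)).2 hs.summable
    have t2 := (summable_nat_add_iff (f := d) (j+1)).2 A.ds
    · refine t1.tsum_le_tsum (fun i => ?_) t2
      refine mul_le_of_le_one_right (A.d0 _) ?_
      exact (Complex.re_le_norm _).trans (Af_prop (A.arg_re hz _)).2
  rw [phi_norm, cay_re_zero h1, ← Real.exp_nat_mul]
  have := Real.add_one_le_exp (((2:ℕ):ℝ) * (-(2 * 0 + (phiE d R z).re)))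
  push_cast at this ⊢
  linarith

end Adm

def zU (U : ℝ) : ℂ := (((U - 1) / (U + 1) : ℝ) : ℂ)

lemma zU_mem {U : ℝ} (hU : 1 ≤ U) : zU U ∈ Metric.ball (0:ℂ) 1 := by
  simp only [zU, Metric.mem_ball, dist_zero_right, Complex.norm_real, Real.norm_eq_abs]
  rw [abs_of_nonneg (div_nonneg (by linarith) (by linarith)), div_lt_one (by linarith)]
  linarith

lemma cay_zU {U : ℝ} (hU : 1 ≤ U) : cay (zU U) = U := by
  have : (U:ℂ) + 1 ≠ 0 := by
    have : (U + 1 : ℝ) ≠ 0 := by linarith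
    exact_mod_cast this
  rw [cay, zU]; push_cast
  rw [div_eq_iff]
  · field_simp; ring
  · have : 1 - ((U:ℂ) - 1) / (U + 1) = 2 / (U + 1) := by field_simp; ring
    rw [this]; exact div_ne_zero two_ne_zero ‹_›

lemma Adm.phi_zU {d R : ℕ → ℝ} (A : Adm d R) {U : ℝ} (hU : 1 ≤ U) : ‖phi d R (zU U)‖ ≤ 1 / 3 := by
  refine (A.phi_le (ball_sub_DD (zU_mem hU))).trans ?_
  rw [cay_zU hU, Complex.ofReal_re, Real.exp_neg, one_div]
  apply inv_anti₀ (by norm_num)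
  linarith [Real.add_one_le_exp (2 * U)]

lemma poisson_zU {U : ℝ} (hU : 1 ≤ U) {z : ℂ} (hz : z ∈ DD) (h1 : ‖z‖ = 1) :
    poissonKernel 0 (zU U) z = U * (1 + ‖cay z‖ ^ 2) / (U ^ 2 + ‖cay z‖ ^ 2) := by
  have hn : z.re ^ 2 + z.im ^ 2 = 1 := by
    have := Complex.normSq_eq_norm_sq z
    rw [Complex.normSq_apply, h1] at this; linarith
  have h2 : ‖1 - z‖ ^ 2 = 2 * (1 - z.re) := by
    rw [← Complex.normSq_eq_norm_sq, Complex.normSq_apply]; simp; nlinarith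
  have h3 : ‖1 + z‖ ^ 2 = 2 * (1 + z.re) := by
    rw [← Complex.normSq_eq_norm_sq, Complex.normSq_apply]; simp; nlinarith
  have hp : 0 < ‖1 - z‖ := norm_pos_iff.2 (DD_ne hz)
  have hx : 0 < 1 - z.re := by nlinarith [pow_pos hp 2]
  have hx2 : 0 ≤ 1 + z.re := by nlinarith [sq_nonneg ‖1 + z‖]
  have hU1 : 0 < U + 1 := by linarith
  have h4 : ‖cay z‖ ^ 2 = (1 + z.re) / (1 - z.re) := by
    rw [cay, norm_div, div_pow, h2, h3]; field_simp
  have h5 : ‖z - zU U‖ ^ 2 = 1 - 2 * z.re * ((U - 1) / (U + 1)) + ((U - 1) / (U + 1)) ^ 2 := by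
    rw [← Complex.normSq_eq_norm_sq, Complex.normSq_apply, zU, Complex.sub_re, Complex.sub_im, Complex.ofReal_re, Complex.ofReal_im]; linear_combination hn
  have h6 : ‖zU U‖ ^ 2 = ((U - 1) / (U + 1)) ^ 2 := by
    rw [zU, Complex.norm_real, Real.norm_eq_abs, sq_abs]
  rw [poissonKernel_def, h4]
  simp only [sub_zero]
  rw [h1, h5, h6]
  have e1 : 1 - 2 * z.re * ((U - 1) / (U + 1)) + ((U - 1) / (U + 1)) ^ 2
      = 2 * (U ^ 2 * (1 - z.re) + (1 + z.re)) / (U + 1) ^ 2 := by field_simp; ring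
  have e2 : 1 ^ 2 - ((U - 1) / (U + 1)) ^ 2 = 4 * U / (U + 1) ^ 2 := by field_simp; ring
  have hD : 0 < U ^ 2 * (1 - z.re) + (1 + z.re) := by positivity
  rw [e1, e2]
  have e3 : U ^ 2 + (1 + z.re) / (1 - z.re) = (U ^ 2 * (1 - z.re) + (1 + z.re)) / (1 - z.re) := by field_simp
  have e4 : 1 + (1 + z.re) / (1 - z.re) = 2 / (1 - z.re) := by field_simp; ring
  rw [e3, e4]
  field_simp
  ring


lemma avg_mono3 {f g h k : ℂ → ℝ} (hf : CircleIntegrable f 0 1) (hg : CircleIntegrable g 0 1)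
    (hh : CircleIntegrable h 0 1) (hk : CircleIntegrable k 0 1) (α β γ : ℝ)
    (H : ∀ z ∈ DD, ‖z‖ = 1 → f z ≤ α * g z + β * h z + γ * k z) :
    Real.circleAverage f 0 1 ≤ α * Real.circleAverage g 0 1 + β * Real.circleAverage h 0 1
      + γ * Real.circleAverage k 0 1 := by
  have i1 : CircleIntegrable (α • g) 0 1 := hg.const_smul
  have i2 : CircleIntegrable (β • h) 0 1 := hh.const_smul
  have i3 : CircleIntegrable (γ • k) 0 1 := hk.const_smul
  have := circleAverage_mono' hf ((i1.add i2).add i3) (fun z hz h1 => by simpa using H z hz h1)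
  rw [Real.circleAverage_add (i1.add i2) i3, Real.circleAverage_add i1 i2,
    Real.circleAverage_smul, Real.circleAverage_smul, Real.circleAverage_smul] at this
  simpa using this

namespace Adm

lemma eval_cont {d R : ℕ → ℝ} (A : Adm d R) (Q : Polynomial ℂ) :
    ContinuousOn (fun z => Q.eval (phi d R z)) DD :=
  Q.continuous.comp_continuousOn A.phi_cont

lemma eval_diff {d R : ℕ → ℝ} (A : Adm d R) (Q : Polynomial ℂ) :
    DifferentiableOn ℂ (fun z => Q.eval (phi d R z)) (Metric.ball 0 1) :=
  Q.differentiable.comp_differentiableOn A.phi_diff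

lemma eval_bdd {d R : ℕ → ℝ} (A : Adm d R) (Q : Polynomial ℂ) :
    ∃ M, ∀ z ∈ DD, ‖Q.eval (phi d R z)‖ ≤ M := by
  obtain ⟨M, hM⟩ := (isCompact_closedBall (0:ℂ) 1).exists_bound_of_continuousOn
    (f := fun z => Q.eval z) Q.continuous.continuousOn
  exact ⟨M, fun z hz => hM _ (by simpa using A.phi_le_one hz)⟩

lemma avgQ {d R : ℕ → ℝ} (A : Adm d R) (Q : Polynomial ℂ) {U : ℝ} (hU : 1 ≤ U) :
    Real.circleAverage (fun z => poissonKernel 0 (zU U) z * (Q.eval (phi d R z)).re) 0 1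
      = (Q.eval (phi d R (zU U))).re := by
  obtain ⟨M, hM⟩ := A.eval_bdd Q
  exact bdry_poisson (A.eval_cont Q) hM (A.eval_diff Q) (zU_mem hU)

lemma intQ {d R : ℕ → ℝ} (A : Adm d R) (Q : Polynomial ℂ) {U : ℝ} (hU : 1 ≤ U) :
    CircleIntegrable (fun z => poissonKernel 0 (zU U) z * (Q.eval (phi d R z)).re) 0 1 := by
  obtain ⟨M, hM⟩ := A.eval_bdd Q
  refine poisson_integrable ?_ (zU_mem hU)
  exact bdry_integrable (M := M) (Complex.continuous_re.comp_continuousOn (A.eval_cont Q))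
    (fun z hz => (Complex.abs_re_le_norm _).trans (hM z hz))

lemma intp {d R : ℕ → ℝ} (A : Adm d R) (Q : Polynomial ℂ) :
    CircleIntegrable (fun z => ‖Q.eval (phi d R z)‖ ^ 2) 0 1 := by
  obtain ⟨M, hM⟩ := A.eval_bdd Q
  refine bdry_integrable (M := M ^ 2) ((A.eval_cont Q).norm.pow 2) (fun z hz => ?_)
  rw [norm_pow, norm_norm]
  exact pow_le_pow_left₀ (norm_nonneg _) (hM z hz) 2

lemma littlewood {d R : ℕ → ℝ} (A : Adm d R) (n : ℕ) (p : Polynomial ℂ) (hp : ∀ k, n ≤ k → p.coeff k = 0) :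
    Real.circleAverage (fun z => ‖p.eval (phi d R z)‖ ^ 2) 0 1 ≤ 2 * polyS n p := by
  obtain ⟨Q, G, hQ0, hG0, H⟩ := poly_maj n p hp
  have hQ : ∀ x : ℂ, ‖x‖ ≤ 1 → 0 ≤ (Q.eval x).re := fun x hx => by
    have := (H x hx).1
    nlinarith [norm_nonneg (p.eval x)]
  have h1 := circleAverage_mono' (A.intp p) (A.intQ Q le_rfl) (fun z hz h1 => by
    rw [poisson_zU le_rfl hz h1, one_mul, one_pow, div_self (by positivity), one_mul]
    exact (H _ (A.phi_le_one hz)).1)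
  rw [A.avgQ Q le_rfl] at h1
  have := (harnack Q hQ _ (A.phi_zU le_rfl)).2
  rw [hQ0] at this
  linarith

lemma upper {d R : ℕ → ℝ} (A : Adm d R) (n : ℕ) (p : Polynomial ℂ) (hp : ∀ k, n ≤ k → p.coeff k = 0)
    (j N : ℕ) :
    Real.circleAverage (fun z => ‖(Polynomial.X ^ N * p).eval (phi d R z)‖ ^ 2) 0 1 ≤
      (8 / R j + 2 * Real.exp (- (d j * N / 2))) * polyS n p := by
  obtain ⟨Q, G, hQ0, hG0, H⟩ := poly_maj n p hp
  have hQ : ∀ x : ℂ, ‖x‖ ≤ 1 → 0 ≤ (Q.eval x).re := fun x hx => by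
    have := (H x hx).1
    nlinarith [norm_nonneg (p.eval x)]
  have hR := A.R4 j
  have hU : 1 ≤ R j / 2 := by linarith
  set U := R j / 2 with hUd
  set ε := Real.exp (- (d j * N / 2)) with hε
  have h1 := avg_mono3 (A.intp (Polynomial.X ^ N * p)) (A.intQ Q hU) (A.intQ Q le_rfl) (A.intQ Q le_rfl)
    (2 / U) ε 0 (fun z hz h1 => by
    rw [poisson_zU le_rfl hz h1, poisson_zU hU hz h1, one_mul, one_pow, div_self (by positivity), one_mul,
      zero_mul, add_zero]
    set x := phi d R z with hx
    set t := ‖cay z‖ with ht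
    have ht0 : 0 ≤ t := norm_nonneg _
    have hx1 := A.phi_le_one hz
    have hb := (H x hx1).1
    have hq := hQ x hx1
    have hD0 : 0 ≤ 2 / U * (U * (1 + t ^ 2) / (U ^ 2 + t ^ 2) * (Q.eval x).re) := by positivity
    have hεq : 0 ≤ ε * (Q.eval x).re := mul_nonneg (Real.exp_pos _).le hq
    have he : ‖(Polynomial.X ^ N * p).eval x‖ ^ 2 = (‖x‖ ^ N) ^ 2 * ‖p.eval x‖ ^ 2 := by
      simp [mul_pow]
    rw [he]
    rcases le_total t U with htU | htU
    · have h2 := A.phi_near hz h1 htU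
      have h3 : (‖x‖ ^ N) ^ 2 ≤ ε := by
        rw [← pow_mul, hε]
        calc ‖x‖ ^ (N * 2) ≤ Real.exp (-(d j / 4)) ^ (N * 2) := pow_le_pow_left₀ (norm_nonneg _) h2 _
          _ = _ := by rw [← Real.exp_nat_mul]; congr 1; push_cast; ring
      have := mul_le_mul h3 hb (by positivity) (Real.exp_pos _).le
      linarith
    · have h3 : (‖x‖ ^ N) ^ 2 ≤ 1 := pow_le_one₀ (by positivity) (pow_le_one₀ (norm_nonneg _) hx1)
      have h4 := mul_le_mul h3 hb (by positivity) zero_le_one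
      have h5 : 1 ≤ 2 / U * (U * (1 + t ^ 2) / (U ^ 2 + t ^ 2)) := by
        have : 2 / U * (U * (1 + t ^ 2) / (U ^ 2 + t ^ 2)) = 2 * (1 + t ^ 2) / (U ^ 2 + t ^ 2) := by
          field_simp
        rw [this, le_div_iff₀ (by positivity)]
        nlinarith
      have h6 := mul_le_mul_of_nonneg_right h5 hq
      linarith)
  rw [A.avgQ Q le_rfl, A.avgQ Q hU] at h1
  have h2 := (harnack Q hQ _ (A.phi_zU le_rfl)).2
  have h3 := (harnack Q hQ _ (A.phi_zU hU)).2
  rw [hQ0] at h2 h3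
  have h4 : 2 / U * (Q.eval (phi d R (zU U))).re ≤ 2 / U * (2 * polyS n p) := by gcongr
  have h5 : ε * (Q.eval (phi d R (zU 1))).re ≤ ε * (2 * polyS n p) :=
    mul_le_mul_of_nonneg_left h2 (Real.exp_pos _).le
  have h6 : 2 / U * (2 * polyS n p) = 8 / R j * polyS n p := by rw [hUd]; field_simp; ring
  linarith

lemma lower {d R : ℕ → ℝ} (A : Adm d R) (n : ℕ) (p : Polynomial ℂ) (hp : ∀ k, n ≤ k → p.coeff k = 0)
    (j : ℕ) (hη : 32 * n * ∑' i, d (i + (j + 1)) ≤ 1) :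
    polyS n p ≤ 128 * R j * Real.circleAverage (fun z => ‖p.eval (phi d R z)‖ ^ 2) 0 1 := by
  obtain ⟨Q, G, hQ0, hG0, H⟩ := poly_maj n p hp
  have hQ : ∀ x : ℂ, ‖x‖ ≤ 1 → 0 ≤ (Q.eval x).re := fun x hx => by
    have := (H x hx).1
    nlinarith [norm_nonneg (p.eval x)]
  have hG : ∀ x : ℂ, ‖x‖ ≤ 1 → 0 ≤ (G.eval x).re := fun x hx => (H x hx).2.2
  have hR := A.R4 j
  set U := R j with hUd
  have hU : 1 ≤ U := by linarith
  set η := ∑' i, d (i + (j + 1)) with hηd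
  have hη0 : 0 ≤ η := tsum_nonneg fun i => A.d0 _
  have hV : 1 ≤ 16 * U := by linarith
  have h1 := avg_mono3 (A.intQ Q hV) (A.intp p) (A.intQ Q hU) (A.intQ G hV)
    (16 * U) (1 / 8) (2 * η) (fun z hz h1 => by
    rw [poisson_zU hV hz h1, poisson_zU hU hz h1]
    set x := phi d R z with hx
    set t := ‖cay z‖ with ht
    have ht0 : 0 ≤ t := norm_nonneg _
    have hx1 := A.phi_le_one hz
    have hb := (H x hx1).2.1
    have hq := hQ x hx1
    have hg := hG x hx1
    set DU := U * (1 + t ^ 2) / (U ^ 2 + t ^ 2) with hDU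
    set DV := 16 * U * (1 + t ^ 2) / ((16 * U) ^ 2 + t ^ 2) with hDV
    have hDU0 : 0 ≤ DU := by positivity
    have hDV0 : 0 ≤ DV := by positivity
    have hDV1 : DV ≤ 16 * U := by
      rw [hDV, div_le_iff₀ (by positivity)]
      have : 1 + t ^ 2 ≤ (16 * U) ^ 2 + t ^ 2 := by nlinarith
      exact mul_le_mul_of_nonneg_left this (by positivity)
    have n1 : 0 ≤ 16 * U * ‖p.eval x‖ ^ 2 := by positivity
    have n2 : 0 ≤ 1 / 8 * (DU * (Q.eval x).re) := by positivity
    have n3 : 0 ≤ 2 * η * (DV * (G.eval x).re) := by positivity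
    rcases le_total t U with htU | htU
    · have h2 : DV ≤ 1 / 8 * DU := by
        have : 1 / 8 * DU = U * (1 + t ^ 2) / (8 * (U ^ 2 + t ^ 2)) := by rw [hDU]; field_simp
        rw [this, hDV, div_le_div_iff₀ (by positivity) (by positivity)]
        have : 16 * (8 * (U ^ 2 + t ^ 2)) ≤ (16 * U) ^ 2 + t ^ 2 := by nlinarith
        calc 16 * U * (1 + t ^ 2) * (8 * (U ^ 2 + t ^ 2)) = U * (1 + t ^ 2) * (16 * (8 * (U ^ 2 + t ^ 2))) := by ring
          _ ≤ _ := mul_le_mul_of_nonneg_left this (by positivity)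
      have := mul_le_mul_of_nonneg_right h2 hq
      linarith
    · have h2 := A.phi_far hz h1 htU
      have h3 := mul_le_mul_of_nonneg_right h2 hg
      have h4 : (Q.eval x).re ≤ ‖p.eval x‖ ^ 2 + 2 * η * (G.eval x).re := hb.trans (by linarith)
      have h5 := mul_le_mul_of_nonneg_left h4 hDV0
      have h6 := mul_le_mul_of_nonneg_right hDV1 (sq_nonneg ‖p.eval x‖)
      nlinarith)
  rw [A.avgQ Q hV, A.avgQ Q hU, A.avgQ G hV] at h1
  have h2 := (harnack Q hQ _ (A.phi_zU hV)).1
  have h3 := (harnack Q hQ _ (A.phi_zU hU)).2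
  have h4 := (harnack G hG _ (A.phi_zU hV)).2
  rw [hQ0] at h2 h3
  have h5 : 2 * η * (G.eval (phi d R (zU (16 * U)))).re ≤ 2 * η * (2 * (n * polyS n p)) :=
    mul_le_mul_of_nonneg_left (by linarith) (by linarith)
  have h6 : 32 * n * η * polyS n p ≤ 1 * polyS n p := mul_le_mul_of_nonneg_right hη (polyS_nonneg n p)
  linarith

end Adm


lemma parseval0 (e : ℕ → ℂ) (he : Summable fun k => ‖e k‖) :
    HasSum (fun k => ‖e k‖ ^ 2) (Real.circleAverage (fun z => ‖∑' k, e k * z ^ k‖ ^ 2) 0 1) := by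
  rw [hasSum_iff_tendsto_nat_of_nonneg (fun k => by positivity)]
  have hp : ∀ n : ℕ, ∑ k ∈ Finset.range n, ‖e k‖ ^ 2 =
      Real.circleAverage (fun z => ‖∑ k ∈ Finset.range n, e k * z ^ k‖ ^ 2) 0 1 := by
    intro n
    set p : Polynomial ℂ := ∑ k ∈ Finset.range n, Polynomial.C (e k) * Polynomial.X ^ k with hpd
    have hc : ∀ k, p.coeff k = if k < n then e k else 0 := by
      intro k; simp [hpd, Polynomial.finsetSum_coeff, Polynomial.coeff_C_mul, Polynomial.coeff_X_pow]
    have h1 := p.sum_sq_norm_coeff_eq_circleAverage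
    have h2 : (fun z => ‖p.eval z‖ ^ 2) = (fun z => ‖∑ k ∈ Finset.range n, e k * z ^ k‖ ^ 2) := by
      funext z; simp [hpd, Polynomial.eval_finsetSum]
    rw [← h2, ← h1]
    symm
    rw [Finset.sum_subset (s₂ := Finset.range n)]
    · refine Finset.sum_congr rfl fun k hk => ?_
      rw [hc, if_pos (by simpa using hk)]
    · intro k hk
      rw [Polynomial.mem_support_iff, hc] at hk
      simp only [Finset.mem_range]
      by_contra hn
      simp [hn] at hk
    · intro k _ hk
      simp [Polynomial.notMem_support_iff.1 hk]
  simp_rw [hp]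
  unfold Real.circleAverage
  refine Tendsto.const_smul ?_ _
  have hs : ∀ t : ℝ, Summable fun k => ‖e k * (circleMap 0 1 t) ^ k‖ := fun t => by simpa using he
  refine intervalIntegral.tendsto_integral_filter_of_dominated_convergence (fun _ => (∑' k, ‖e k‖) ^ 2) ?_ ?_ ?_ ?_
  · refine Eventually.of_forall fun n => Continuous.aestronglyMeasurable ?_
    fun_prop
  · refine Eventually.of_forall fun n => Eventually.of_forall fun t _ => ?_
    rw [norm_pow, norm_norm]
    refine pow_le_pow_left₀ (norm_nonneg _) ?_ 2
    refine (norm_sum_le _ _).trans ?_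
    simp only [norm_mul, norm_pow, norm_circleMap_zero, abs_one, one_pow, mul_one]
    exact he.sum_le_tsum _ (fun k _ => norm_nonneg _)
  · simp
  · refine Eventually.of_forall fun t _ => ?_
    exact ((hs t).of_norm.hasSum.tendsto_sum_nat).norm.pow 2

lemma hardy_key {F : ℂ → ℂ} {M : ℝ} (hF : ContinuousOn F DD) (hM : ∀ z ∈ DD, ‖F z‖ ≤ M)
    (c : ℕ → ℂ) (hc : ∀ z ∈ Metric.ball (0:ℂ) 1, HasSum (fun k => c k * z ^ k) (F z)) :
    HasSum (fun k => ‖c k‖ ^ 2) (Real.circleAverage (fun z => ‖F z‖ ^ 2) 0 1) := by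
  set B := Real.circleAverage (fun z => ‖F z‖ ^ 2) 0 1 with hB
  have hlim : Tendsto (fun r : ℝ => Real.circleAverage (fun z => ‖F (r * z)‖ ^ 2) 0 1)
      (nhdsWithin 1 (Set.Iio 1)) (nhds B) := by
    have := bdry_tendsto (F := fun z => ‖F z‖ ^ 2) (M := M ^ 2) (hF.norm.pow 2)
      (fun z hz => by rw [norm_pow, norm_norm]; exact pow_le_pow_left₀ (norm_nonneg _) (hM z hz) 2)
      (K := fun _ => 1) continuousOn_const
    simpa using this
  have hmem : ∀ᶠ r : ℝ in nhdsWithin 1 (Set.Iio 1), r ∈ Set.Ico (0:ℝ) 1 := by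
    filter_upwards [self_mem_nhdsWithin, mem_nhdsWithin_of_mem_nhds (lt_mem_nhds (zero_lt_one))] with r h1 h2
    exact ⟨h2.le, h1⟩
  have hpar : ∀ r ∈ Set.Ico (0:ℝ) 1, HasSum (fun k => ‖c k * (r:ℂ) ^ k‖ ^ 2)
      (Real.circleAverage (fun z => ‖F (r * z)‖ ^ 2) 0 1) := by
    intro r hr
    have h1 := (hc (r : ℂ) (by simpa [abs_of_nonneg hr.1] using hr.2)).summable.norm
    have h2 := parseval0 _ h1
    convert h2 using 1
    refine Real.circleAverage_congr_sphere fun z hz => ?_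
    have hz : ‖z‖ = 1 := by simpa using hz
    have h3 := hc _ (smul_mem_DD hz.le hr)
    rw [← h3.tsum_eq]
    congr 3
    funext k
    ring
  have hfin : ∀ s : Finset ℕ, ∑ k ∈ s, ‖c k‖ ^ 2 ≤ B := by
    intro s
    have h1 : Tendsto (fun r : ℝ => ∑ k ∈ s, ‖c k * (r:ℂ) ^ k‖ ^ 2) (nhdsWithin 1 (Set.Iio 1))
        (nhds (∑ k ∈ s, ‖c k‖ ^ 2)) := by
      have : Continuous (fun r : ℝ => ∑ k ∈ s, ‖c k * (r:ℂ) ^ k‖ ^ 2) := by fun_prop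
      have := (this.tendsto 1).mono_left (nhdsWithin_le_nhds (s := Set.Iio 1))
      simpa using this
    refine le_of_tendsto_of_tendsto h1 hlim ?_
    filter_upwards [hmem] with r hr
    exact sum_le_hasSum s (fun k _ => by positivity) (hpar r hr)
  have hsum : Summable fun k => ‖c k‖ ^ 2 := summable_of_sum_le (fun k => by positivity) hfin
  have hle : B ≤ ∑' k, ‖c k‖ ^ 2 := by
    refine le_of_tendsto hlim ?_
    filter_upwards [hmem] with r hr
    refine hasSum_le (fun k => ?_) (hpar r hr) hsum.hasSum
    refine pow_le_pow_left₀ (norm_nonneg _) ?_ 2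
    rw [norm_mul, norm_pow, Complex.norm_real, Real.norm_eq_abs, abs_of_nonneg hr.1]
    exact mul_le_of_le_one_right (norm_nonneg _) (pow_le_one₀ hr.1 hr.2.le)
  have : ∑' k, ‖c k‖ ^ 2 = B := le_antisymm (hsum.tsum_le_of_sum_le hfin) hle
  rw [← this]; exact hsum.hasSum

lemma H2_normsq (b : H2) : HasSum (fun k => ‖b k‖ ^ 2) (‖b‖ ^ 2) := by
  have := lp.hasSum_norm (p := 2) (by norm_num) b
  simpa using this

lemma H2_mem (c : ℕ → ℂ) (h : Summable fun k => ‖c k‖ ^ 2) : ∃ b : H2, ∀ k, b k = c k := by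
  refine ⟨⟨c, ?_⟩, fun k => rfl⟩
  refine (memℓp_gen_iff (by norm_num)).2 ?_
  simpa using h

lemma H2_ev {z : ℂ} (hz : ‖z‖ < 1) : ∃ E : H2 →L[ℂ] ℂ, ∀ a : H2, HasSum (fun k => a k * z ^ k) (E a) := by
  obtain ⟨w, hw⟩ := H2_mem (fun k => (starRingEnd ℂ) z ^ k) (by
    simp only [norm_pow, RCLike.norm_conj]
    have := summable_geometric_of_lt_one (r := ‖z‖ ^ 2) (by positivity) (by nlinarith [norm_nonneg z])
    refine this.congr fun k => by ring)
  refine ⟨innerSL ℂ w, fun a => ?_⟩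
  have := lp.hasSum_inner (𝕜 := ℂ) w a
  simpa [hw] using this

lemma fa_hasSum {z : ℂ} (hz : ‖z‖ < 1) (a : H2) : HasSum (fun k => a k * z ^ k) (fa a z) := by
  obtain ⟨E, hE⟩ := H2_ev hz
  exact (hE a).summable.hasSum

namespace Adm

lemma exists_b {d R : ℕ → ℝ} (A : Adm d R) (n : ℕ) :
    ∃ b : H2, ∀ z : ℂ, ‖z‖ < 1 → fa b z = phi d R z ^ n := by
  have hd : DifferentiableOn ℂ (fun z => phi d R z ^ n) (Metric.ball 0 1) := A.phi_diff.pow n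
  set c : ℕ → ℂ := fun k => ((k.factorial : ℂ)⁻¹) * iteratedDeriv k (fun z => phi d R z ^ n) 0 with hc
  have hs : ∀ z ∈ Metric.ball (0:ℂ) 1, HasSum (fun k => c k * z ^ k) (phi d R z ^ n) := by
    intro z hz
    have := Complex.hasSum_taylorSeries_on_ball hd hz
    have he : (fun k => c k * z ^ k) = fun k : ℕ => (k.factorial : ℂ)⁻¹ • (z - 0) ^ k •
        iteratedDeriv k (fun z => phi d R z ^ n) 0 := by
      funext k
      simp [hc]; ring
    rw [he]; exact this
  have h1 := hardy_key (F := fun z => phi d R z ^ n) (M := 1) (A.phi_cont.pow n)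
    (fun z hz => by rw [norm_pow]; exact pow_le_one₀ (norm_nonneg _) (A.phi_le_one hz)) c hs
  obtain ⟨b, hb⟩ := H2_mem c h1.summable
  refine ⟨b, fun z hz => ?_⟩
  have := fa_hasSum hz b
  simp_rw [hb] at this
  exact this.unique (hs z (by simpa using hz))

end Adm

/-- image of polynomials -/
def Tp (b : ℕ → H2) (n : ℕ) (p : Polynomial ℂ) : H2 := ∑ k ∈ Finset.range n, p.coeff k • b k

namespace Adm

lemma Tp_norm {d R : ℕ → ℝ} (A : Adm d R) {b : ℕ → H2}
    (hb : ∀ n, ∀ z : ℂ, ‖z‖ < 1 → fa (b n) z = phi d R z ^ n) (n : ℕ) (p : Polynomial ℂ)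
    (hp : ∀ k, n ≤ k → p.coeff k = 0) :
    ‖Tp b n p‖ ^ 2 = Real.circleAverage (fun z => ‖p.eval (phi d R z)‖ ^ 2) 0 1 := by
  obtain ⟨M, hM⟩ := A.eval_bdd p
  refine (H2_normsq _).unique ?_
  refine hardy_key (A.eval_cont p) hM _ (fun z hz => ?_)
  have hz : ‖z‖ < 1 := by simpa using hz
  obtain ⟨E, hE⟩ := H2_ev hz
  convert hE (Tp b n p) using 1
  have hEb : ∀ k, E (b k) = phi d R z ^ k := fun k => by
    rw [← hb k z hz]; exact (hE _).unique (fa_hasSum hz _)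
  rw [Tp, map_sum]
  simp only [map_smul, hEb, smul_eq_mul]
  by_cases h0 : p = 0
  · simp [h0]
  · have : p.natDegree < n := by
      by_contra hn
      exact h0 (Polynomial.leadingCoeff_eq_zero.1 (hp _ (not_lt.1 hn)))
    exact Polynomial.eval_eq_sum_range' this _

end Adm


def polF (a : ℕ → ℂ) (s : Finset ℕ) : Polynomial ℂ := ∑ k ∈ s, Polynomial.C (a k) * Polynomial.X ^ k

lemma polF_coeff (a : ℕ → ℂ) (s : Finset ℕ) (k : ℕ) : (polF a s).coeff k = if k ∈ s then a k else 0 := by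
  simp [polF, Polynomial.finsetSum_coeff, Polynomial.coeff_C_mul, Polynomial.coeff_X_pow]

lemma polF_S (a : ℕ → ℂ) (s : Finset ℕ) {n : ℕ} (hn : s ⊆ Finset.range n) :
    polyS n (polF a s) = ∑ k ∈ s, ‖a k‖ ^ 2 := by
  rw [polyS, ← Finset.sum_subset hn]
  · exact Finset.sum_congr rfl fun k hk => by rw [polF_coeff, if_pos hk]
  · intro k _ hk
    rw [polF_coeff, if_neg hk]; simp

lemma polF_T (a : ℕ → ℂ) (s : Finset ℕ) {n : ℕ} (hn : s ⊆ Finset.range n) (b : ℕ → H2) :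
    Tp b n (polF a s) = ∑ k ∈ s, a k • b k := by
  rw [Tp, ← Finset.sum_subset hn]
  · exact Finset.sum_congr rfl fun k hk => by rw [polF_coeff, if_pos hk]
  · intro k _ hk
    rw [polF_coeff, if_neg hk]; simp

lemma polF_zero (a : ℕ → ℂ) (s : Finset ℕ) {n : ℕ} (hn : s ⊆ Finset.range n) (k : ℕ) (hk : n ≤ k) :
    (polF a s).coeff k = 0 := by
  rw [polF_coeff, if_neg]
  intro h
  have := Finset.mem_range.1 (hn h)
  omega

lemma fin_sub (s : Finset ℕ) : ∃ n, s ⊆ Finset.range n := s.exists_nat_subset_range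

namespace Adm

lemma F1 {d R : ℕ → ℝ} (A : Adm d R) {b : ℕ → H2}
    (hb : ∀ n, ∀ z : ℂ, ‖z‖ < 1 → fa (b n) z = phi d R z ^ n) (a : ℕ → ℂ) (s : Finset ℕ) :
    ‖∑ k ∈ s, a k • b k‖ ^ 2 ≤ 2 * ∑ k ∈ s, ‖a k‖ ^ 2 := by
  obtain ⟨n, hn⟩ := fin_sub s
  rw [← polF_T a s hn b, ← polF_S a s hn, A.Tp_norm hb n _ (polF_zero a s hn)]
  exact A.littlewood n _ (polF_zero a s hn)

lemma F2 {d R : ℕ → ℝ} (A : Adm d R) {b : ℕ → H2}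
    (hb : ∀ n, ∀ z : ℂ, ‖z‖ < 1 → fa (b n) z = phi d R z ^ n) (a : ℕ → ℂ) (s : Finset ℕ)
    (j N : ℕ) (hs : ∀ k ∈ s, N ≤ k) :
    ‖∑ k ∈ s, a k • b k‖ ^ 2 ≤ (8 / R j + 2 * Real.exp (- (d j * N / 2))) * ∑ k ∈ s, ‖a k‖ ^ 2 := by
  obtain ⟨n, hn⟩ := fin_sub s
  have hn' : s ⊆ Finset.range (N + n) := hn.trans (Finset.range_mono (by omega))
  obtain ⟨h, hh⟩ : Polynomial.X ^ N ∣ polF a s := by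
    rw [Polynomial.X_pow_dvd_iff]
    intro k hk
    rw [polF_coeff, if_neg]
    intro h
    have := hs k h
    omega
  have hc : ∀ m, h.coeff m = (polF a s).coeff (N + m) := fun m => by
    rw [hh, add_comm, Polynomial.coeff_X_pow_mul]
  have hz : ∀ k, n ≤ k → h.coeff k = 0 := fun k hk => by
    rw [hc]; exact polF_zero a s hn' _ (by omega)
  have hS : polyS n h ≤ ∑ k ∈ s, ‖a k‖ ^ 2 := by
    rw [← polF_S a s hn', polyS, polyS, Finset.sum_range_add]
    simp only [hc]
    have : 0 ≤ ∑ x ∈ Finset.range N, ‖(polF a s).coeff x‖ ^ 2 := Finset.sum_nonneg fun _ _ => by positivity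
    linarith
  rw [← polF_T a s hn b, A.Tp_norm hb n _ (polF_zero a s hn), hh]
  have hR := A.Rpos j
  exact (A.upper n h hz j N).trans (mul_le_mul_of_nonneg_left hS (by positivity))

lemma F3 {d R : ℕ → ℝ} (A : Adm d R) {b : ℕ → H2}
    (hb : ∀ n, ∀ z : ℂ, ‖z‖ < 1 → fa (b n) z = phi d R z ^ n) (a : ℕ → ℂ) (n j : ℕ)
    (hη : 32 * n * ∑' i, d (i + (j + 1)) ≤ 1) :
    ∑ k ∈ Finset.range n, ‖a k‖ ^ 2 ≤ 128 * R j * ‖∑ k ∈ Finset.range n, a k • b k‖ ^ 2 := by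
  have hn : Finset.range n ⊆ Finset.range n := subset_rfl
  rw [← polF_T a _ hn b, ← polF_S a _ hn, A.Tp_norm hb n _ (polF_zero a _ hn)]
  exact A.lower n _ (polF_zero a _ hn) j hη

lemma Tsum {d R : ℕ → ℝ} (A : Adm d R) {b : ℕ → H2}
    (hb : ∀ n, ∀ z : ℂ, ‖z‖ < 1 → fa (b n) z = phi d R z ^ n) (a : H2) :
    Summable fun k => a k • b k := by
  rw [summable_iff_vanishing_norm]
  intro ε hε
  have h1 := summable_iff_vanishing_norm.1 (H2_normsq a).summable (ε ^ 2 / 2) (by positivity)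
  obtain ⟨s, hs⟩ := h1
  refine ⟨s, fun t ht => ?_⟩
  have h2 := hs t ht
  have h3 := A.F1 hb a t
  have h4 := (le_abs_self _).trans_lt h2
  exact lt_of_pow_lt_pow_left₀ 2 hε.le (by linarith)

lemma main {d R : ℕ → ℝ} (A : Adm d R) : ∃ T : H2 →L[ℂ] H2,
    (∀ (a : H2) (z : ℂ), ‖z‖ < 1 → fa (T a) z = fa a (phi d R z)) ∧
    (∀ j N : ℕ, ∃ S : H2 →L[ℂ] H2, FiniteDimensional ℂ (LinearMap.range S.toLinearMap) ∧
      Module.finrank ℂ (LinearMap.range S.toLinearMap) ≤ N ∧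
      ‖T - S‖ ^ 2 ≤ 8 / R j + 2 * Real.exp (- (d j * N / 2))) ∧
    (∀ j n : ℕ, 1 ≤ n → 32 * n * ∑' i, d (i + (j + 1)) ≤ 1 → ∀ S : H2 →L[ℂ] H2,
      FiniteDimensional ℂ (LinearMap.range S.toLinearMap) →
      Module.finrank ℂ (LinearMap.range S.toLinearMap) ≤ n - 1 → 1 ≤ 128 * R j * ‖T - S‖ ^ 2) := by
  classical
  choose b hb using A.exists_b
  have hsq : ∀ (a : H2) (s : Finset ℕ), ∑ k ∈ s, ‖a k‖ ^ 2 ≤ ‖a‖ ^ 2 := fun a s =>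
    sum_le_hasSum s (fun k _ => by positivity) (H2_normsq a)
  let T0 : H2 →ₗ[ℂ] H2 :=
    { toFun := fun a => ∑' k, a k • b k
      map_add' := fun x y => by
        rw [← (A.Tsum hb x).tsum_add (A.Tsum hb y)]
        simp only [lp.coeFn_add, Pi.add_apply, add_smul]
      map_smul' := fun c x => by
        simp only [RingHom.id_apply]
        rw [← (A.Tsum hb x).tsum_const_smul]
        simp only [lp.coeFn_smul, Pi.smul_apply, smul_eq_mul, mul_smul] }
  let T : H2 →L[ℂ] H2 := T0.mkContinuous (Real.sqrt 2) (fun a => by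
    refine le_of_tendsto (A.Tsum hb a).hasSum.norm (Eventually.of_forall fun s => ?_)
    refine abs_le_of_sq_le_sq' ?_ (by positivity) |>.2
    rw [mul_pow, Real.sq_sqrt (by norm_num)]
    have := A.F1 hb a s
    have := hsq a s
    linarith)
  have hT : ∀ a : H2, HasSum (fun k => a k • b k) (T a) := fun a => (A.Tsum hb a).hasSum
  refine ⟨T, ?_, ?_, ?_⟩
  · intro a z hz
    obtain ⟨E, hE⟩ := H2_ev hz
    have hEf : ∀ x, E x = fa x z := fun x => (hE x).unique (fa_hasSum hz x)
    have h1 := E.hasSum (hT a)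
    have h2 : (fun k => E (a k • b k)) = fun k => a k * phi d R z ^ k := by
      funext k; rw [map_smul, hEf, hb _ z hz, smul_eq_mul]
    rw [h2, hEf] at h1
    refine h1.unique (fa_hasSum ?_ a)
    exact A.phi_lt_one (by simpa using hz)
  · intro j N
    let S : H2 →L[ℂ] H2 := ∑ k ∈ Finset.range N, (lp.evalCLM ℂ (fun _ : ℕ => ℂ) 2 k).smulRight (b k)
    have hS : ∀ a : H2, S a = ∑ k ∈ Finset.range N, a k • b k := fun a => by
      simp only [S, sum_apply, ContinuousLinearMap.smulRight_apply]
      rfl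
    have hle : LinearMap.range S.toLinearMap ≤ Submodule.span ℂ (((Finset.range N).image b : Finset H2) : Set H2) := by
      rintro _ ⟨a, rfl⟩
      change S a ∈ _
      rw [hS]
      refine Submodule.sum_mem _ fun k hk => Submodule.smul_mem _ _ (Submodule.subset_span ?_)
      exact Finset.mem_coe.2 (Finset.mem_image_of_mem b hk)
    have hfd : FiniteDimensional ℂ (Submodule.span ℂ (((Finset.range N).image b : Finset H2) : Set H2)) :=
      FiniteDimensional.span_finset ℂ _
    refine ⟨S, Submodule.finiteDimensional_of_le hle, ?_, ?_⟩
    · refine (Submodule.finrank_mono hle).trans ((finrank_span_finset_le_card _).trans ?_)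
      exact Finset.card_image_le.trans (by simp)
    · have hR := A.Rpos j
      set ε := 8 / R j + 2 * Real.exp (- (d j * N / 2)) with hε
      have hε0 : 0 ≤ ε := by positivity
      have : ‖T - S‖ ≤ Real.sqrt ε := by
        refine ContinuousLinearMap.opNorm_le_bound _ (Real.sqrt_nonneg _) fun a => ?_
        have h1 : Tendsto (fun n => ∑ k ∈ Finset.range n, a k • b k - S a) atTop (nhds ((T - S) a)) :=
          (hT a).tendsto_sum_nat.sub_const _
        refine le_of_tendsto h1.norm ?_
        filter_upwards [eventually_ge_atTop N] with n hn
        rw [hS, ← Finset.sum_Ico_eq_sub _ hn]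
        refine abs_le_of_sq_le_sq' ?_ (by positivity) |>.2
        rw [mul_pow, Real.sq_sqrt hε0]
        refine (A.F2 hb a _ j N (fun k hk => (Finset.mem_Ico.1 hk).1)).trans ?_
        exact mul_le_mul_of_nonneg_left (hsq a _) hε0
      calc ‖T - S‖ ^ 2 ≤ Real.sqrt ε ^ 2 := pow_le_pow_left₀ (norm_nonneg _) this 2
        _ = ε := Real.sq_sqrt hε0
  · intro j n hn hη S hfd hrk
    let J : (Fin n → ℂ) →ₗ[ℂ] H2 := Fintype.linearCombination ℂ (fun k : Fin n => lp.single 2 (k:ℕ) (1:ℂ))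
    let Lm : (Fin n → ℂ) →ₗ[ℂ] LinearMap.range S.toLinearMap := S.toLinearMap.rangeRestrict ∘ₗ J
    have hker : LinearMap.ker Lm ≠ ⊥ := by
      apply LinearMap.ker_ne_bot_of_finrank_lt
      simp only [Module.finrank_fin_fun]
      omega
    obtain ⟨c, hc, hc0⟩ := Submodule.exists_mem_ne_zero_of_ne_bot hker
    set x := J c with hx
    have hSx : S x = 0 := by
      have := congrArg Subtype.val (LinearMap.mem_ker.1 hc)
      simpa [Lm] using this
    have hxc : ∀ m : ℕ, x m = if h : m < n then c ⟨m, h⟩ else 0 := by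
      intro m
      have : x m = ∑ k : Fin n, c k * (lp.single 2 (k:ℕ) (1:ℂ) : H2) m := by
        have h1 : x m = lp.evalCLM ℂ (fun _ : ℕ => ℂ) 2 m x := rfl
        rw [h1, hx]
        simp only [J, Fintype.linearCombination_apply, map_sum, map_smul]
        rfl
      rw [this]
      split_ifs with h
      · rw [Finset.sum_eq_single ⟨m, h⟩]
        · simp
        · intro k _ hk
          have : m ≠ k := fun e => hk (Fin.ext e.symm)
          simp [lp.single_apply, this]
        · simp
      · refine Finset.sum_eq_zero fun k _ => ?_
        have : m ≠ k := fun e => h (by omega)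
        simp [lp.single_apply, this]
    have hx0 : ∀ k ∉ Finset.range n, x k = 0 := fun k hk => by
      rw [hxc, dif_neg (by simpa using hk)]
    have hxn : ‖x‖ ^ 2 = ∑ k ∈ Finset.range n, ‖x k‖ ^ 2 :=
      (H2_normsq x).unique (hasSum_sum_of_ne_finset_zero fun k hk => by rw [hx0 k hk]; simp)
    have hTx : T x = ∑ k ∈ Finset.range n, x k • b k :=
      (hT x).unique (hasSum_sum_of_ne_finset_zero fun k hk => by rw [hx0 k hk]; simp)
    have hxne : x ≠ 0 := by
      intro h
      apply hc0
      funext k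
      have := hxc k
      rw [h] at this
      simpa using this.symm
    have h3 := A.F3 hb x n j hη
    rw [← hTx, ← hxn] at h3
    have h4 : ‖T x‖ ≤ ‖T - S‖ * ‖x‖ := by
      have := (T - S).le_opNorm x
      simpa [hSx] using this
    have h5 : ‖T x‖ ^ 2 ≤ ‖T - S‖ ^ 2 * ‖x‖ ^ 2 := by
      rw [← mul_pow]; exact pow_le_pow_left₀ (norm_nonneg _) h4 2
    have hR := A.Rpos j
    have h6 : 1 * ‖x‖ ^ 2 ≤ 128 * R j * ‖T - S‖ ^ 2 * ‖x‖ ^ 2 := by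
      rw [one_mul, mul_assoc]
      exact h3.trans (mul_le_mul_of_nonneg_left h5 (by positivity))
    exact le_of_mul_le_mul_right h6 (pow_pos (norm_pos_iff.2 hxne) 2)

end Adm


lemma finrank_compact (S : H2 →L[ℂ] H2) (hfd : FiniteDimensional ℂ (LinearMap.range S.toLinearMap)) :
    IsCompactOperator (⇑S) := by
  haveI : ProperSpace (LinearMap.range S.toLinearMap) := FiniteDimensional.proper ℂ _
  refine ⟨Subtype.val '' Metric.closedBall (0 : LinearMap.range S.toLinearMap) 1,
    (isCompact_closedBall _ _).image continuous_subtype_val, ?_⟩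
  have h1 : S ⁻¹' Metric.closedBall 0 1 ∈ nhds (0 : H2) :=
    S.continuous.continuousAt.preimage_mem_nhds (by
      rw [map_zero]; exact Metric.closedBall_mem_nhds _ one_pos)
  refine mem_of_superset h1 fun x hx => ?_
  refine ⟨⟨S x, ⟨x, rfl⟩⟩, ?_, rfl⟩
  simpa using hx

lemma approx_le (T S : H2 →L[ℂ] H2) (n : ℕ)
    (hfd : FiniteDimensional ℂ (LinearMap.range S.toLinearMap))
    (hr : Module.finrank ℂ (LinearMap.range S.toLinearMap) ≤ n - 1) : approxNum T n ≤ ‖T - S‖ :=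
  csInf_le ⟨0, by rintro _ ⟨R, _, _, rfl⟩; exact norm_nonneg _⟩ ⟨S, hfd, hr, rfl⟩

lemma le_approx (T : H2 →L[ℂ] H2) (n : ℕ) (c : ℝ)
    (h : ∀ S : H2 →L[ℂ] H2, FiniteDimensional ℂ (LinearMap.range S.toLinearMap) →
      Module.finrank ℂ (LinearMap.range S.toLinearMap) ≤ n - 1 → c ≤ ‖T - S‖) : c ≤ approxNum T n := by
  refine le_csInf ⟨‖T - 0‖, 0, ?_, ?_, rfl⟩ ?_
  · rw [ContinuousLinearMap.toLinearMap_zero, LinearMap.range_zero]; infer_instance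
  · rw [ContinuousLinearMap.toLinearMap_zero, LinearMap.range_zero, finrank_bot]; omega
  · rintro _ ⟨S, h1, h2, rfl⟩
    exact h S h1 h2

def NN (j : ℕ) : ℕ := 2 ^ 2 ^ j

lemma NN_succ (j : ℕ) : NN (j + 1) = NN j ^ 2 := by
  rw [NN, NN, ← pow_mul, pow_succ]

lemma NN_mono : Monotone NN := fun i j h => by
  unfold NN; gcongr <;> norm_num

lemma NN_ge (j : ℕ) : 2 ^ j ≤ NN j := by
  unfold NN; gcongr
  · norm_num
  · exact Nat.lt_two_pow_self.le

lemma NN_two (j : ℕ) : 2 ≤ NN j := by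
  have := NN_mono (Nat.zero_le j)
  simpa [NN] using this

def RR (γ : ℕ → ℝ) (j : ℕ) : ℝ := 4 * γ 0 ^ 2 / γ j ^ 2
def dd (γ : ℕ → ℝ) (j : ℕ) : ℝ := 4 * Real.log (RR γ j) / NN j

lemma seq_constr (γ : ℕ → ℝ) (hpos : ∀ j, 0 < γ j) (hanti : Antitone γ) (δ : ℝ) (hδ : 0 < δ) (hδ1 : δ ≤ 1)
    (hr : ∀ j, δ * γ j ≤ γ (j + 1)) :
    Adm (dd γ) (RR γ) ∧ ∃ s : ℕ, ∀ j n : ℕ, n ≤ NN (j + 1) →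
      32 * n * ∑' i, dd γ (i + (j + s + 1)) ≤ 1 := by
  have hR4 : ∀ j, 4 ≤ RR γ j := fun j => by
    have h0 := hpos j
    rw [RR, le_div_iff₀ (by positivity)]
    have := pow_le_pow_left₀ h0.le (hanti (Nat.zero_le j)) 2
    linarith
  have hRm : Monotone (RR γ) := fun i j h => by
    have h0 := hpos j
    unfold RR
    exact div_le_div_of_nonneg_left (by positivity) (by positivity) (pow_le_pow_left₀ h0.le (hanti h) 2)
  have hδn : ∀ j, δ ^ j * γ 0 ≤ γ j := fun j => by
    induction j with
    | zero => simp
    | succ k ih => 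
      have := mul_le_mul_of_nonneg_left ih hδ.le
      have := hr k
      rw [pow_succ]; linarith
  set l := -Real.log δ with hl
  have hl0 : 0 ≤ l := by have := Real.log_nonpos hδ.le hδ1; linarith
  have hlog : ∀ j : ℕ, Real.log (RR γ j) ≤ (2 + 2 * l) * (j + 1) := fun j => by
    have h0 := hpos j
    have h00 := hpos 0
    have h1 : RR γ j ≤ 4 * (δ⁻¹ ^ j) ^ 2 := by
      rw [RR, div_le_iff₀ (by positivity)]
      have h2 := pow_le_pow_left₀ (by positivity) (hδn j) 2
      have h3 : 4 * (δ⁻¹ ^ j) ^ 2 * (δ ^ j * γ 0) ^ 2 = 4 * γ 0 ^ 2 := by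
        rw [inv_pow]; field_simp
      rw [← h3]
      exact mul_le_mul_of_nonneg_left h2 (by positivity)
    have h2 := Real.log_le_log (by linarith [hR4 j]) h1
    rw [Real.log_mul (by norm_num) (by positivity), Real.log_pow, Real.log_pow, Real.log_inv] at h2
    have h4 : Real.log 4 ≤ 2 := by
      have : (4:ℝ) = 2 ^ 2 := by norm_num
      rw [this, Real.log_pow]
      have := Real.log_two_lt_d9
      push_cast; linarith
    push_cast at h2
    have hj : (0:ℝ) ≤ j := Nat.cast_nonneg j
    nlinarith [mul_nonneg hl0 hj]
  have hlog0 : ∀ j, 0 ≤ Real.log (RR γ j) := fun j => Real.log_nonneg (by linarith [hR4 j])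
  have hN0 : ∀ j, (0:ℝ) < NN j := fun j => by
    have := NN_two j
    exact_mod_cast (by omega : 0 < NN j)
  set w : ℕ → ℝ := fun i => 4 * ((2 + 2 * l) * (i + 2)) / NN i with hw
  have hw0 : ∀ i, 0 ≤ w i := fun i => by have := hN0 i; positivity
  have hws : Summable w := by
    have h1 := summable_pow_mul_geometric_of_norm_lt_one (R := ℝ) 1 (r := 1 / 2) (by norm_num)
    have h2 := summable_geometric_of_lt_one (r := (1/2 : ℝ)) (by norm_num) (by norm_num)
    have h3 := (h1.add (h2.mul_left 2)).mul_left (4 * (2 + 2 * l))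
    refine Summable.of_nonneg_of_le hw0 (fun i => ?_) h3
    have h4 : (2:ℝ) ^ i ≤ NN i := by exact_mod_cast NN_ge i
    calc w i ≤ 4 * ((2 + 2 * l) * (i + 2)) / 2 ^ i := by
          simp only [hw]; gcongr
      _ = _ := by
          rw [one_div, inv_pow]; field_simp
  have hd0 : ∀ i, 0 ≤ dd γ i := fun i => by
    have := hN0 i; have := hlog0 i; unfold dd; positivity
  have hds : Summable (dd γ) := by
    refine Summable.of_nonneg_of_le hd0 (fun i => ?_) hws
    have := hN0 i
    simp only [hw, dd]
    refine div_le_div_of_nonneg_right ?_ this.le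
    have := hlog i
    nlinarith
  refine ⟨⟨hd0, hds, hR4, hRm⟩, ?_⟩
  have ht := tendsto_sum_nat_add w
  have hev := (ht.eventually (ge_mem_nhds (show (0:ℝ) < 1 / 32 by norm_num))).and (eventually_ge_atTop 1)
  obtain ⟨s, hs⟩ := eventually_atTop.1 hev
  refine ⟨s, fun j n hn => ?_⟩
  have hs1 := (hs s le_rfl).2
  have hs2 := (hs (j + s) (by omega)).1
  have hsum : Summable fun i => dd γ (i + (j + s + 1)) := (summable_nat_add_iff (j + s + 1)).2 hds
  have hsumw : Summable fun i => w (i + (j + s)) := (summable_nat_add_iff (j + s)).2 hws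
  have key : (n : ℝ) * ∑' i, dd γ (i + (j + s + 1)) ≤ ∑' i, w (i + (j + s)) := by
    rw [← tsum_mul_left]
    refine (hsum.mul_left _).tsum_le_tsum (fun i => ?_) hsumw
    set m := i + (j + s) with hm
    have e : i + (j + s + 1) = m + 1 := by omega
    have hnm : (n : ℝ) ≤ NN m := by
      have : NN (j + 1) ≤ NN m := NN_mono (by omega)
      exact_mod_cast hn.trans this
    have hNm := hN0 m
    have hlg := hlog (m + 1)
    have hlg0 := hlog0 (m + 1)
    rw [e, dd, NN_succ]
    push_cast at hlg ⊢
    calc (n:ℝ) * (4 * Real.log (RR γ (m + 1)) / (NN m : ℝ) ^ 2)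
        ≤ NN m * (4 * Real.log (RR γ (m + 1)) / (NN m : ℝ) ^ 2) := by gcongr
      _ = 4 * Real.log (RR γ (m + 1)) / NN m := by field_simp
      _ ≤ w m := by
          simp only [hw]
          refine div_le_div_of_nonneg_right ?_ hNm.le
          nlinarith
  linarith

theorem stmt2 (g : ℝ → ℝ)
    (hg_pos : ∀ x : ℝ, 1 ≤ x → 0 < g x)
    (hg_anti : AntitoneOn g (Set.Ici 1))
    (hg_lim : Tendsto g atTop (nhds 0))
    (hg_ratio : ∃ δ : ℝ, 0 < δ ∧ ∀ x : ℝ, 1 ≤ x → δ ≤ g (x ^ 2) / g x) :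
    ∃ (φ : ℂ → ℂ) (T : H2 →L[ℂ] H2) (c C : ℝ),
      DifferentiableOn ℂ φ (Metric.ball 0 1) ∧
      Set.MapsTo φ (Metric.ball 0 1) (Metric.ball 0 1) ∧
      (∀ (a : H2) (z : ℂ), ‖z‖ < 1 → fa (T a) z = fa a (φ z)) ∧
      0 < c ∧ c ≤ C ∧
      IsCompactOperator (⇑T) ∧
      ∀ n : ℕ, 1 ≤ n → c * g n ≤ approxNum T n ∧ approxNum T n ≤ C * g n := by
  obtain ⟨δ, hδ, hratio⟩ := hg_ratio
  set γ : ℕ → ℝ := fun j => g (NN j) with hγ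
  have hN1 : ∀ j, (1:ℝ) ≤ NN j := fun j => by
    have := NN_two j
    exact_mod_cast (by omega : 1 ≤ NN j)
  have hpos : ∀ j, 0 < γ j := fun j => hg_pos _ (hN1 j)
  have hanti : Antitone γ := fun i j h =>
    hg_anti (hN1 i) (hN1 j) (by exact_mod_cast NN_mono h)
  have hr : ∀ j, δ * γ j ≤ γ (j + 1) := fun j => by
    have h1 := hratio (NN j) (hN1 j)
    rw [le_div_iff₀ (hpos j)] at h1
    simp only [hγ, NN_succ]
    push_cast
    exact h1
  have hδ1 : δ ≤ 1 := by
    have h1 := hr 0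
    have h2 := hanti (Nat.zero_le 1)
    have h3 := hpos 0
    by_contra h
    nlinarith
  have hγ0 := hpos 0
  have hg1 := hg_pos 1 le_rfl
  have hg10 : γ 0 ≤ g 1 := hg_anti (by simp) (hN1 0) (hN1 0)
  obtain ⟨A, s, hs⟩ := seq_constr γ hpos hanti δ hδ hδ1 hr
  obtain ⟨T, hT, hup, hlow⟩ := A.main
  have hδs : ∀ j k, δ ^ k * γ j ≤ γ (j + k) := fun j k => by
    induction k with
    | zero => simp
    | succ k ih =>
      have := mul_le_mul_of_nonneg_left ih hδ.le
      have := hr (j + k)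
      rw [pow_succ, ← add_assoc]; linarith
  -- good finite rank approximations
  have hup2 : ∀ j N : ℕ, NN j ≤ 2 * N → ∃ S : H2 →L[ℂ] H2, FiniteDimensional ℂ (LinearMap.range S.toLinearMap) ∧
      Module.finrank ℂ (LinearMap.range S.toLinearMap) ≤ N ∧ ‖T - S‖ ≤ 2 * γ j / γ 0 := by
    intro j N hN
    obtain ⟨S, h1, h2, h3⟩ := hup j N
    refine ⟨S, h1, h2, ?_⟩
    have hR := A.R4 j
    have hj := hpos j
    have hNj := hN1 j
    have hlog0 : 0 ≤ Real.log (RR γ j) := Real.log_nonneg (by linarith)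
    have h4 : Real.log (RR γ j) ≤ dd γ j * N / 2 := by
      have hN' : (NN j : ℝ) ≤ 2 * N := by exact_mod_cast hN
      have : dd γ j * N / 2 = Real.log (RR γ j) * (2 * N / NN j) := by
        rw [dd]; field_simp; ring
      rw [this]
      refine le_mul_of_one_le_right hlog0 ?_
      rw [le_div_iff₀ (by linarith)]; linarith
    have h5 : Real.exp (-(dd γ j * N / 2)) ≤ 1 / RR γ j := by
      rw [one_div, ← Real.exp_log (show 0 < RR γ j by linarith), ← Real.exp_neg]
      exact Real.exp_le_exp.2 (by linarith)
    refine abs_le_of_sq_le_sq' ?_ (by positivity) |>.2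
    have h6 : 8 / RR γ j + 2 * (1 / RR γ j) = 10 / RR γ j := by ring
    have h7 : 10 / RR γ j = 10 / 4 * (γ j / γ 0) ^ 2 := by rw [RR]; field_simp
    have h8 : (2 * γ j / γ 0) ^ 2 = 4 * (γ j / γ 0) ^ 2 := by ring
    nlinarith [sq_nonneg (γ j / γ 0)]
  have hlow2 : ∀ j n : ℕ, 1 ≤ n → n ≤ NN (j + 1) → δ ^ s * γ j / (23 * γ 0) ≤ approxNum T n := by
    intro j n h1 hn
    refine le_approx T n _ fun S hS1 hS2 => ?_
    have h2 := hlow (j + s) n h1 (hs j n hn) S hS1 hS2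
    have hj := hpos (j + s)
    have h3 : γ (j + s) / (23 * γ 0) ≤ ‖T - S‖ := by
      refine abs_le_of_sq_le_sq' ?_ (norm_nonneg _) |>.2
      rw [RR] at h2
      have h4 : 128 * (4 * γ 0 ^ 2 / γ (j + s) ^ 2) * ‖T - S‖ ^ 2
          = 512 * γ 0 ^ 2 * ‖T - S‖ ^ 2 / γ (j + s) ^ 2 := by ring
      rw [h4, le_div_iff₀ (by positivity)] at h2
      rw [div_pow, div_le_iff₀ (by positivity)]
      nlinarith [mul_nonneg (sq_nonneg (γ 0)) (sq_nonneg ‖T - S‖)]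
    refine le_trans ?_ h3
    exact div_le_div_of_nonneg_right (hδs j s) (by positivity)
  have hδs1 : δ ^ s ≤ 1 := pow_le_one₀ hδ.le hδ1
  refine ⟨phi (dd γ) (RR γ), T, δ ^ s / (23 * g 1), 2 / (δ * γ 0), A.phi_diff, ?_, hT, by positivity, ?_, ?_, ?_⟩
  · intro z hz
    simpa using A.phi_lt_one hz
  · rw [div_le_div_iff₀ (by positivity) (by positivity)]
    have h1 : δ ^ s * (δ * γ 0) ≤ 1 * (1 * g 1) := by gcongr
    linarith
  · choose S hS1 hS2 hS3 using fun j => hup2 j (NN j) (by omega)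
    have hNt : Tendsto (fun j => ((NN j : ℕ) : ℝ)) atTop atTop := by
      refine tendsto_natCast_atTop_atTop.comp ?_
      exact tendsto_atTop_mono NN_ge (tendsto_pow_atTop_atTop_of_one_lt (by norm_num))
    have hγt : Tendsto (fun j => 2 * γ j / γ 0) atTop (nhds 0) := by
      have := ((hg_lim.comp hNt).const_mul 2).div_const (γ 0)
      simpa using this
    have : Tendsto S atTop (nhds T) := by
      rw [tendsto_iff_norm_sub_tendsto_zero]
      refine squeeze_zero (fun _ => norm_nonneg _) (fun j => ?_) hγt
      rw [norm_sub_rev]; exact hS3 j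
    exact isCompactOperator_of_tendsto this (Eventually.of_forall fun j => finrank_compact _ (hS1 j))
  · intro n hn
    rcases Nat.lt_or_ge n 2 with h2 | h2
    · have hn1 : n = 1 := by omega
      subst hn1
      simp only [Nat.cast_one]
      constructor
      · have h3 := hlow2 0 1 le_rfl (by have := NN_two 1; simpa using (by omega : 1 ≤ NN 1))
        refine le_trans (le_of_eq ?_) h3
        field_simp
      · obtain ⟨S, hS1, hS2, hS3⟩ := hup 0 0
        refine (approx_le T S 1 hS1 (by simpa using hS2)).trans ?_
        have hR0 : RR γ 0 = 4 := by rw [RR]; field_simp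
        rw [hR0] at hS3
        norm_num at hS3
        have h4 : ‖T - S‖ ≤ 2 := abs_le_of_sq_le_sq' (by linarith) (by norm_num) |>.2
        refine h4.trans ?_
        rw [div_mul_eq_mul_div, le_div_iff₀ (by positivity)]
        have h1 : δ * γ 0 ≤ 1 * g 1 := by gcongr
        linarith
    · set j := Nat.log 2 (Nat.log 2 n) with hj
      have hlog : Nat.log 2 n ≠ 0 := by
        have := Nat.log_pos (b := 2) (by norm_num) h2
        omega
      have hlo : NN j ≤ n := by
        have h3 : 2 ^ j ≤ Nat.log 2 n := Nat.pow_log_le_self 2 hlog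
        exact (Nat.pow_le_pow_right (by norm_num) h3).trans (Nat.pow_log_le_self 2 (by omega))
      have hhi : n ≤ NN (j + 1) := by
        have h3 : Nat.log 2 n + 1 ≤ 2 ^ (j + 1) := Nat.lt_pow_succ_log_self (by norm_num) _
        have h4 : n < 2 ^ (Nat.log 2 n + 1) := Nat.lt_pow_succ_log_self (by norm_num) _
        exact h4.le.trans (Nat.pow_le_pow_right (by norm_num) h3)
      have hn1 : (1:ℝ) ≤ n := by exact_mod_cast hn
      have hgn := hg_pos n hn1
      have hgn1 : g n ≤ γ j := hg_anti (hN1 j) hn1 (by exact_mod_cast hlo)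
      have hgn2 : γ (j + 1) ≤ g n := hg_anti hn1 (hN1 (j + 1)) (by exact_mod_cast hhi)
      constructor
      · refine le_trans ?_ (hlow2 j n hn hhi)
        rw [div_mul_eq_mul_div]
        have := hpos j
        gcongr
      · obtain ⟨S, hS1, hS2, hS3⟩ := hup2 j (n - 1) (by omega)
        refine (approx_le T S n hS1 hS2).trans (hS3.trans ?_)
        have h3 := hr j
        rw [div_mul_eq_mul_div, div_le_div_iff₀ (by positivity) (by positivity)]
        have : δ * γ j ≤ g n := h3.trans hgn2
        nlinarith

end
end

section
/- Let U ∈ 𝒰 be continuously differentiable on (0,π) with U' bounded on [π/2, π), and suppose t·U'(t)/U(t) → 0 as t → 0⁺. Then the conjugate function V satisfies V(t)/U(t) → 0 as t → 0⁺. -/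
open MeasureTheory Filter Set

noncomputable section

noncomputable def hU (U : ℝ → ℝ) (t : ℝ) : ℝ := ∫ x in t..Real.pi, U x / x ^ 2

def ClassU (U : ℝ → ℝ) : Prop :=
  Continuous U ∧ (∀ t, U (-t) = U t) ∧ Function.Periodic U (2 * Real.pi) ∧
  U 0 = 0 ∧ MonotoneOn U (Set.Icc 0 Real.pi) ∧
  (∀ t, 0 < t → t ≤ Real.pi → 0 < U t) ∧
  Tendsto (fun t => hU U t) (nhdsWithin 0 (Set.Ioi 0)) atTop

noncomputable def conjFun (U : ℝ → ℝ) (t : ℝ) : ℝ :=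
  (1 / (2 * Real.pi)) * (∫ x in (0 : ℝ)..t, (U (t - x) - U (t + x)) / Real.tan (x / 2)) -
  (1 / (2 * Real.pi)) * (∫ x in t..Real.pi, (U (x + t) - U (x - t)) / Real.tan (x / 2))

lemma cotb {x : ℝ} (h0 : 0 < x) (h1 : x ≤ Real.pi) : 0 ≤ 1 / Real.tan (x/2) ∧ 1 / Real.tan (x/2) ≤ 2 / x := by
  rcases eq_or_lt_of_le h1 with h | h
  · subst h
    rw [Real.tan_pi_div_two]
    simp
    positivity
  · have h2 : x/2 < Real.tan (x/2) := Real.lt_tan (by linarith) (by linarith)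
    have h3 : 0 < Real.tan (x/2) := by linarith
    refine ⟨by positivity, ?_⟩
    rw [div_le_div_iff₀ h3 h0]
    linarith

lemma tan_cont {f : ℝ → ℝ} (hf : Continuous f) {a b : ℝ} (ha : 0 < a) (hab : a ≤ b) (hb : b ≤ Real.pi) :
    IntervalIntegrable (fun x => f x / Real.tan (x/2)) volume a b := by
  apply ContinuousOn.intervalIntegrable
  rw [uIcc_of_le hab]
  have : (fun x => f x / Real.tan (x/2)) = fun x => f x * (Real.cos (x/2) / Real.sin (x/2)) := by
    ext x
    rw [Real.tan_eq_sin_div_cos, div_div_eq_mul_div, mul_div_assoc]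
  rw [this]
  apply hf.continuousOn.mul
  apply ContinuousOn.div (by fun_prop) (by fun_prop)
  intro x hx
  have := Real.sin_pos_of_pos_of_lt_pi (x := x/2) (by linarith [hx.1]) (by linarith [hx.2, Real.pi_pos])
  exact this.ne'

/-- the local setting -/
structure Loc (U U' : ℝ → ℝ) (ε δ : ℝ) : Prop where
  cont : Continuous U
  mono : MonotoneOn U (Set.Icc 0 Real.pi)
  pos : ∀ t, 0 < t → t ≤ Real.pi → 0 < U t
  der : ∀ t ∈ Set.Ioo (0 : ℝ) Real.pi, HasDerivAt U (U' t) t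
  e0 : 0 < ε
  e1 : ε ≤ 1/6
  d0 : 0 < δ
  d1 : δ < Real.pi
  sm : ∀ y, 0 < y → y ≤ δ → y * U' y ≤ ε * U y

variable {U U' : ℝ → ℝ} {ε δ : ℝ}

lemma Loc.mono' (L : Loc U U' ε δ) {a b : ℝ} (ha : 0 ≤ a) (hab : a ≤ b) (hb : b ≤ δ) : U a ≤ U b :=
  L.mono ⟨ha, by linarith [L.d1]⟩ ⟨by linarith, by linarith [L.d1]⟩ hab

lemma Loc.slope (L : Loc U U' ε δ) {a b : ℝ} (ha : 0 < a) (hab : a ≤ b) (hb : b ≤ δ) :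
    U b - U a ≤ (b - a) * (ε * U b / a) := by
  rcases eq_or_lt_of_le hab with h | h
  · subst h; simp
  have hd := L.d1
  obtain ⟨c, hc, hc'⟩ := exists_hasDerivAt_eq_slope U U' h L.cont.continuousOn
    (fun x hx => L.der x ⟨by linarith [hx.1], by linarith [hx.2]⟩)
  have hcpos : 0 < c := by linarith [hc.1]
  have h1 := L.sm c hcpos (by linarith [hc.2])
  have h2 : U c ≤ U b := L.mono' hcpos.le hc.2.le hb
  have h3 : U' c ≤ ε * U b / a := by
    have h4 : U' c ≤ ε * U b / c := by
      rw [le_div_iff₀ hcpos]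
      nlinarith [L.e0]
    refine h4.trans ?_
    have := L.pos b (by linarith) (by linarith)
    have := L.e0
    exact div_le_div_of_nonneg_left (by positivity) ha hc.1.le
  rw [eq_div_iff (by linarith)] at hc'
  nlinarith

lemma Loc.four (L : Loc U U' ε δ) {t : ℝ} (ht : 0 < t) (hb : 4 * t ≤ δ) :
    U (4*t) ≤ (1 + 6 * ε) * U t ∧ U (4*t) ≤ 2 * U t := by
  have h := L.slope ht (by linarith : t ≤ 4 * t) hb
  have h2 : (4 * t - t) * (ε * U (4*t) / t) = 3 * ε * U (4*t) := by field_simp; ring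
  rw [h2] at h
  have h0 := L.e0
  have h1 := L.e1
  have hp := L.pos t ht (by linarith [L.d1])
  have hp4 := L.pos (4*t) (by linarith) (by linarith [L.d1])
  have : U (4*t) ≤ 2 * U t := by nlinarith
  refine ⟨by nlinarith, this⟩

lemma Loc.int (L : Loc U U' ε δ) {t : ℝ} (ht : 0 < t) (hb : t ≤ δ) :
    (1 - ε) * U t ≤ (∫ x in (0:ℝ)..t, U x) / t := by
  have hd := L.d1
  have key : MonotoneOn (fun s => (∫ x in (0:ℝ)..s, U x) - (1 - ε) * (s * U s)) (Icc 0 t) := by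
    have hc := L.cont
    have hder : ∀ s ∈ Ioo 0 t, HasDerivAt (fun s => (∫ x in (0:ℝ)..s, U x) - (1 - ε) * (s * U s))
        (U s - (1 - ε) * (1 * U s + s * U' s)) s := by
      intro s hs
      refine HasDerivAt.sub (hc.integral_hasStrictDerivAt 0 s).hasDerivAt ?_
      exact ((hasDerivAt_id s).mul (L.der s ⟨hs.1, by linarith [hs.2]⟩)).const_mul _
    apply monotoneOn_of_deriv_nonneg (convex_Icc _ _)
    · apply ContinuousOn.sub
      · intro s hs
        exact (hc.integral_hasStrictDerivAt 0 s).hasDerivAt.continuousAt.continuousWithinAt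
      · fun_prop
    · intro s hs
      rw [interior_Icc] at hs
      exact (hder s hs).differentiableAt.differentiableWithinAt
    · intro s hs
      rw [interior_Icc] at hs
      rw [(hder s hs).deriv]
      have h1 := L.sm s hs.1 (by linarith [hs.2])
      have := L.e0
      have := L.e1
      have hp := L.pos s hs.1 (by linarith [hs.2])
      have : (1 - ε) * (s * U' s) ≤ (1-ε) * (ε * U s) := by gcongr; linarith
      have : 0 < ε * (ε * U s) := by positivity
      nlinarith
  have := key ⟨le_rfl, ht.le⟩ ⟨ht.le, le_rfl⟩ ht.le
  simp at this
  rw [le_div_iff₀ ht]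
  linarith

lemma Loc.tail (L : Loc U U' ε δ) {a b : ℝ} (ha : 0 < a) (hab : a ≤ b) (hb : b ≤ δ) :
    ∫ x in a..b, U x / x^2 ≤ 2 * U a / a := by
  have hd := L.d1
  have hc := L.cont
  have hcq : ContinuousOn (fun x => U x / x^2) (Ioi 0) := by
    apply hc.continuousOn.div (by fun_prop)
    intro x hx
    have : 0 < x := hx
    positivity
  have hI : ∀ s, a ≤ s → HasDerivAt (fun s => ∫ x in a..s, U x / x^2) (U s / s^2) s := by
    intro s hs
    have hn : Ioi (0:ℝ) ∈ nhds s := Ioi_mem_nhds (by linarith)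
    refine intervalIntegral.integral_hasDerivAt_right ?_ ?_ (hcq.continuousAt hn)
    · apply ContinuousOn.intervalIntegrable
      rw [uIcc_of_le hs]
      exact hcq.mono (fun x hx => lt_of_lt_of_le ha hx.1)
    · exact hcq.stronglyMeasurableAtFilter isOpen_Ioi s (by exact (by linarith : 0 < s))
  have key : AntitoneOn (fun s => (∫ x in a..s, U x / x^2) + 2 * (U s / s)) (Icc a b) := by
    have hder : ∀ s ∈ Ioo a b, HasDerivAt (fun s => (∫ x in a..s, U x / x^2) + 2 * (U s / s))
        (U s / s^2 + 2 * ((U' s * s - U s * 1) / s^2)) s := by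
      intro s hs
      have hs0 : 0 < s := by linarith [hs.1]
      refine HasDerivAt.add (hI s hs.1.le) ?_
      exact ((L.der s ⟨hs0, by linarith [hs.2]⟩).div (hasDerivAt_id s) hs0.ne').const_mul _
    apply antitoneOn_of_deriv_nonpos (convex_Icc _ _)
    · apply ContinuousOn.add
      · intro s hs
        exact (hI s hs.1).continuousAt.continuousWithinAt
      · refine ContinuousOn.mul (by fun_prop) (hc.continuousOn.div (by fun_prop) ?_)
        intro s hs
        have := hs.1
        linarith
    · intro s hs
      rw [interior_Icc] at hs
      exact (hder s hs).differentiableAt.differentiableWithinAt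
    · intro s hs
      rw [interior_Icc] at hs
      have hs0 : 0 < s := by linarith [hs.1]
      rw [(hder s hs).deriv]
      have h1 := L.sm s hs0 (by linarith [hs.2])
      have := L.e0
      have := L.e1
      have hp := L.pos s hs0 (by linarith [hs.2])
      have e : U s / s^2 + 2 * ((U' s * s - U s * 1) / s^2) = (2 * (s * U' s) - U s) / s^2 := by
        field_simp; ring
      rw [e]
      apply div_nonpos_of_nonpos_of_nonneg _ (by positivity)
      nlinarith
  have := key ⟨le_rfl, hab⟩ ⟨hab, le_rfl⟩ hab
  simp at this
  have hp : 0 < U b / b := div_pos (L.pos b (by linarith) (by linarith)) (by linarith)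
  rw [mul_div_assoc]
  linarith

lemma Loc.I1 (L : Loc U U' ε δ) {t : ℝ} (ht : 0 < t) (hb : 4 * t ≤ δ) :
    |∫ x in (0 : ℝ)..t, (U (t - x) - U (t + x)) / Real.tan (x / 2)| ≤ 44 * ε * U t := by
  have hd := L.d1
  have hc := L.cont
  have e0 := L.e0
  have hb1 : ∀ x ∈ Ioc 0 t, ‖(U (t - x) - U (t + x)) / Real.tan (x / 2)‖ ≤
      8 * ε * U (2*t) / t + 4 / t * (U (2*t) - U (t - x)) := by
    intro x hx
    have hx0 := hx.1
    have hxt := hx.2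
    obtain ⟨c0, c1⟩ := cotb hx.1 (by linarith)
    have m1 : U (t-x) ≤ U (t+x) := L.mono' (by linarith) (by linarith) (by linarith)
    have m2 : U (t+x) ≤ U (2*t) := L.mono' (by linarith) (by linarith) (by linarith)
    have p2 := L.pos (2*t) (by linarith) (by linarith)
    rw [div_eq_mul_one_div, norm_mul, Real.norm_eq_abs, Real.norm_eq_abs, abs_of_nonneg c0, abs_of_nonpos (by linarith)]
    have s1 : -(U (t - x) - U (t + x)) * (1 / Real.tan (x/2)) ≤ (U (t+x) - U (t-x)) * (2 / x) := by
      rw [neg_sub]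
      exact mul_le_mul_of_nonneg_left c1 (by linarith)
    refine s1.trans ?_
    rcases le_total x (t/2) with h | h
    · have s2 := L.slope (a := t - x) (b := t + x) (by linarith) (by linarith) (by linarith)
      have s3 : ε * U (t+x) / (t-x) ≤ ε * U (2*t) / (t/2) := by
        apply div_le_div₀ (by positivity) (by gcongr) (by positivity) (by linarith)
      have s4 : U (t+x) - U (t-x) ≤ (2 * x) * (ε * U (2*t) / (t/2)) := by
        refine s2.trans ?_
        have : t + x - (t - x) = 2 * x := by ring
        rw [this]
        gcongr
      have : 0 ≤ 4 / t * (U (2*t) - U (t - x)) := mul_nonneg (by positivity) (by linarith)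
      have s5 : (U (t+x) - U (t-x)) * (2/x) ≤ (2 * x) * (ε * U (2*t) / (t/2)) * (2/x) := by gcongr
      have : (2 * x) * (ε * U (2*t) / (t/2)) * (2/x) = 8 * ε * U (2*t) / t := by field_simp; ring
      linarith
    · have : 0 ≤ 8 * ε * U (2*t) / t := by positivity
      have s2 : 2 / x ≤ 4 / t := by
        rw [div_le_div_iff₀ hx0 ht]; linarith
      have : (U (t+x) - U (t-x)) * (2/x) ≤ (U (2*t) - U (t-x)) * (4/t) := by
        apply mul_le_mul (by linarith) s2 (by positivity) (by linarith)
      linarith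
  have hg : IntervalIntegrable (fun x => 8 * ε * U (2*t) / t + 4 / t * (U (2*t) - U (t - x))) volume 0 t := by
    apply Continuous.intervalIntegrable; fun_prop
  have := intervalIntegral.norm_integral_le_of_norm_le ht.le (ae_of_all _ hb1) hg
  rw [Real.norm_eq_abs] at this
  refine this.trans ?_
  have i0 : IntervalIntegrable (fun x => U (t - x)) volume 0 t := by
    apply Continuous.intervalIntegrable; fun_prop
  have i1 : (∫ x in (0:ℝ)..t, U (t - x)) = ∫ x in (0:ℝ)..t, U x := by
    rw [intervalIntegral.integral_comp_sub_left]; simp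
  rw [intervalIntegral.integral_add (by simp) ((intervalIntegrable_const.sub i0).const_mul _),
    intervalIntegral.integral_const_mul, intervalIntegral.integral_sub (by simp) i0, i1]
  simp only [intervalIntegral.integral_const, smul_eq_mul, sub_zero]
  have j := L.int ht (by linarith)
  obtain ⟨f1, f2⟩ := L.four ht hb
  have m : U (2*t) ≤ U (4*t) := L.mono' (by linarith) (by linarith) (by linarith)
  have e : t * (8 * ε * U (2 * t) / t) + 4 / t * (t * U (2 * t) - ∫ (x : ℝ) in (0:ℝ)..t, U x)
    = 8 * ε * U (2*t) + 4 * U (2*t) - 4 * ((∫ (x : ℝ) in (0:ℝ)..t, U x) / t) := by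
    field_simp; ring
  rw [e]
  have : ε * U (2*t) ≤ ε * (2 * U t) := by gcongr; linarith
  nlinarith

lemma Loc.I2a (L : Loc U U' ε δ) {t : ℝ} (ht : 0 < t) (hb : 4 * t ≤ δ) :
    |∫ x in t..(2*t), (U (x + t) - U (x - t)) / Real.tan (x / 2)| ≤ 14 * ε * U t := by
  have hd := L.d1
  have hc := L.cont
  have e0 := L.e0
  have hb1 : ∀ x ∈ Ioc t (2*t), ‖(U (x + t) - U (x - t)) / Real.tan (x / 2)‖ ≤
      2 / t * (U (4*t) - U (x - t)) := by
    intro x hx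
    have hx0 := hx.1
    have hxt := hx.2
    obtain ⟨c0, c1⟩ := cotb (x := x) (by linarith) (by linarith)
    have m1 : U (x-t) ≤ U (x+t) := L.mono' (by linarith) (by linarith) (by linarith)
    have m2 : U (x+t) ≤ U (4*t) := L.mono' (by linarith) (by linarith) (by linarith)
    rw [div_eq_mul_one_div, norm_mul, Real.norm_eq_abs, Real.norm_eq_abs, abs_of_nonneg c0, abs_of_nonneg (by linarith), mul_comm]
    have c2 : 2 / x ≤ 2 / t := by gcongr
    exact mul_le_mul (c1.trans c2) (by linarith) (by linarith) (by positivity)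
  have hg : IntervalIntegrable (fun x => 2 / t * (U (4*t) - U (x - t))) volume t (2*t) := by
    apply Continuous.intervalIntegrable; fun_prop
  have := intervalIntegral.norm_integral_le_of_norm_le (by linarith) (ae_of_all _ hb1) hg
  rw [Real.norm_eq_abs] at this
  refine this.trans ?_
  have i0 : IntervalIntegrable (fun x => U (x - t)) volume t (2*t) := by
    apply Continuous.intervalIntegrable; fun_prop
  have i1 : (∫ x in t..(2*t), U (x - t)) = ∫ x in (0:ℝ)..t, U x := by
    rw [intervalIntegral.integral_comp_sub_right]; ring_nf
  rw [intervalIntegral.integral_const_mul, intervalIntegral.integral_sub (by simp) i0, i1]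
  simp only [intervalIntegral.integral_const, smul_eq_mul]
  have j := L.int ht (by linarith)
  obtain ⟨f1, f2⟩ := L.four ht hb
  have e : 2 / t * ((2 * t - t) * U (4 * t) - ∫ (x : ℝ) in (0:ℝ)..t, U x)
    = 2 * U (4*t) - 2 * ((∫ (x : ℝ) in (0:ℝ)..t, U x) / t) := by
    field_simp; ring
  rw [e]
  nlinarith

lemma Loc.I2b (L : Loc U U' ε δ) {t : ℝ} (ht : 0 < t) (hb : 2 * t ≤ δ / 4) :
    |∫ x in (2*t)..(δ/4), (U (x + t) - U (x - t)) / Real.tan (x / 2)| ≤ 32 * ε * U t := by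
  have hd := L.d1
  have hc := L.cont
  have e0 := L.e0
  have d0 := L.d0
  have hb1 : ∀ x ∈ Ioc (2*t) (δ/4), ‖(U (x + t) - U (x - t)) / Real.tan (x / 2)‖ ≤
      16 * t * ε * (U x / x ^ 2) := by
    intro x hx
    have hx0 := hx.1
    have hxt := hx.2
    have xp : 0 < x := by linarith
    obtain ⟨c0, c1⟩ := cotb (x := x) (by linarith) (by linarith)
    have m1 : U (x-t) ≤ U (x+t) := L.mono' (by linarith) (by linarith) (by linarith)
    have m2 : U (x+t) ≤ U (4*x) := L.mono' (by linarith) (by linarith) (by linarith)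
    have p := L.pos x (by linarith) (by linarith)
    have p' := L.pos (x+t) (by linarith) (by linarith)
    have f := (L.four xp (by linarith)).2
    have s2 := L.slope (a := x - t) (b := x + t) (by linarith) (by linarith) (by linarith)
    have s3 : ε * U (x+t) / (x-t) ≤ ε * (2 * U x) / (x/2) := by
      apply div_le_div₀ (by positivity) (by gcongr; linarith) (by positivity) (by linarith)
    have s4 : U (x+t) - U (x-t) ≤ (2 * t) * (ε * (2 * U x) / (x/2)) := by
      refine s2.trans ?_
      have : x + t - (x - t) = 2 * t := by ring
      rw [this]
      gcongr
    rw [div_eq_mul_one_div, norm_mul, Real.norm_eq_abs, Real.norm_eq_abs, abs_of_nonneg c0, abs_of_nonneg (by linarith)]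
    calc _ ≤ ((2 * t) * (ε * (2 * U x) / (x/2))) * (2 / x) :=
          mul_le_mul s4 c1 c0 (by positivity)
      _ = _ := by field_simp; ring
  have hg : IntervalIntegrable (fun x => 16 * t * ε * (U x / x ^ 2)) volume (2*t) (δ/4) := by
    apply ContinuousOn.intervalIntegrable
    rw [uIcc_of_le hb]
    refine ContinuousOn.mul (by fun_prop) (hc.continuousOn.div (by fun_prop) ?_)
    intro s hs
    have := hs.1
    have : 0 < s := by linarith
    positivity
  have := intervalIntegral.norm_integral_le_of_norm_le hb (ae_of_all _ hb1) hg
  rw [Real.norm_eq_abs] at this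
  refine this.trans ?_
  rw [intervalIntegral.integral_const_mul]
  have T := L.tail (a := 2*t) (b := δ/4) (by linarith) hb (by linarith)
  have f := (L.four ht (by linarith)).2
  have m : U (2*t) ≤ U (4*t) := L.mono' (by linarith) (by linarith) (by linarith)
  calc _ ≤ 16 * t * ε * (2 * U (2*t) / (2*t)) := by gcongr
    _ = 16 * ε * U (2*t) := by field_simp
    _ ≤ 16 * ε * (2 * U t) := by gcongr; linarith
    _ = _ := by ring

lemma lip (hc : Continuous U) (hev : ∀ t, U (-t) = U t) (hper : Function.Periodic U (2 * Real.pi))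
    (hderiv : ∀ t ∈ Set.Ioo (0 : ℝ) Real.pi, HasDerivAt U (U' t) t)
    (hcont : ContinuousOn U' (Set.Ioo 0 Real.pi))
    (hbdd : ∃ Cb : ℝ, ∀ t ∈ Set.Ico (Real.pi / 2) Real.pi, |U' t| ≤ Cb)
    {η : ℝ} (h0 : 0 < η) (h1 : η < Real.pi / 2) :
    ∃ C, 0 ≤ C ∧ ∀ t x, 0 < t → t ≤ η / 2 → η ≤ x → x ≤ Real.pi → |U (x + t) - U (x - t)| ≤ C * t := by
  obtain ⟨Cb, hCb⟩ := hbdd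
  have hsub : Icc (η/2) (Real.pi/2) ⊆ Ioo 0 Real.pi := fun x hx =>
    ⟨by linarith [hx.1], by linarith [hx.2, Real.pi_pos]⟩
  obtain ⟨C1, hC1⟩ := isCompact_Icc.exists_bound_of_continuousOn (hcont.mono hsub)
  set C := max (max C1 Cb) 0 with hC
  have hC0 : 0 ≤ C := le_max_right _ _
  have hB : ∀ y ∈ Ico (η/2) Real.pi, |U' y| ≤ C := by
    intro y hy
    rcases le_total y (Real.pi/2) with h | h
    · exact (hC1 y ⟨hy.1, h⟩).trans ((le_max_left _ _).trans (le_max_left _ _))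
    · exact (hCb y ⟨h, hy.2⟩).trans ((le_max_right _ _).trans (le_max_left _ _))
  have key : ∀ a b, η/2 ≤ a → a ≤ b → b ≤ Real.pi → |U b - U a| ≤ C * (b - a) := by
    intro a b ha hab hb
    rcases eq_or_lt_of_le hab with h | h
    · subst h; simp
    obtain ⟨c, hcc, hc'⟩ := exists_hasDerivAt_eq_slope U U' h hc.continuousOn
      (fun x hx => hderiv x ⟨by linarith [hx.1], by linarith [hx.2]⟩)
    rw [eq_div_iff (by linarith)] at hc'
    rw [← hc', abs_mul, abs_of_pos (show 0 < b - a by linarith)]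
    exact mul_le_mul_of_nonneg_right (hB c ⟨by linarith [hcc.1], by linarith [hcc.2]⟩) (by linarith)
  refine ⟨2 * C, by positivity, ?_⟩
  intro t x ht ht' hx hx'
  rcases le_total (x + t) Real.pi with h | h
  · refine (key _ _ (by linarith) (by linarith) h).trans (le_of_eq (by ring))
  · have e : U (x + t) = U (2 * Real.pi - x - t) := by
      rw [← hev, ← hper]; congr 1; ring
    rw [e]
    refine (key _ _ (by linarith) (by linarith) (by linarith)).trans ?_
    nlinarith

theorem stmt16 (U U' : ℝ → ℝ) (hU_mem : ClassU U)
    (hderiv : ∀ t ∈ Set.Ioo (0 : ℝ) Real.pi, HasDerivAt U (U' t) t)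
    (hcont : ContinuousOn U' (Set.Ioo 0 Real.pi))
    (hbdd : ∃ Cb : ℝ, ∀ t ∈ Set.Ico (Real.pi / 2) Real.pi, |U' t| ≤ Cb)
    (hsmall : Tendsto (fun t => t * U' t / U t) (nhdsWithin 0 (Set.Ioi 0)) (nhds 0)) :
    Tendsto (fun t => conjFun U t / U t) (nhdsWithin 0 (Set.Ioi 0)) (nhds 0) := by
  obtain ⟨hc, hev, hper, hz, hmono, hpos, hinf⟩ := hU_mem
  have pp := Real.pi_pos
  have p3 := Real.pi_gt_three
  rw [Metric.tendsto_nhds]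
  intro r hr
  set ε := min (1/6) (r / 182) with hε
  have e0 : 0 < ε := by positivity
  have er : ε ≤ r / 182 := min_le_right _ _
  -- get δ
  obtain ⟨δ, d0, d1, hsm⟩ : ∃ δ, 0 < δ ∧ δ < Real.pi ∧ ∀ y, 0 < y → y ≤ δ → y * U' y ≤ ε * U y := by
    have h := (Metric.tendsto_nhds.mp hsmall) ε e0
    rw [eventually_nhdsWithin_iff, Metric.eventually_nhds_iff] at h
    obtain ⟨d, hd, h⟩ := h
    refine ⟨min (d/2) 1, by positivity, by linarith [min_le_right (d/2) 1], ?_⟩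
    intro y hy hy'
    have y1 : y ≤ d/2 := hy'.trans (min_le_left _ _)
    have y2 : y ≤ 1 := hy'.trans (min_le_right _ _)
    have h2 := h (y := y) (by rw [dist_zero_right, Real.norm_eq_abs, abs_of_pos hy]; linarith) hy
    rw [dist_zero_right, Real.norm_eq_abs] at h2
    have hp := hpos y hy (by linarith)
    have h3 := (le_abs_self _).trans h2.le
    rwa [div_le_iff₀ hp] at h3
  have L : Loc U U' ε δ := ⟨hc, hmono, hpos, hderiv, e0, min_le_left _ _, d0, d1, hsm⟩
  obtain ⟨C, hC0, hC⟩ := lip hc hev hper hderiv hcont hbdd (η := δ/4) (by positivity) (by linarith)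
  set M := C * (8 / δ) * Real.pi with hM
  have M0 : 0 ≤ M := by positivity
  -- t small relative to U t
  have hev1 : ∀ᶠ t in nhdsWithin (0:ℝ) (Ioi 0), 2 * (M / ε) + hU U δ ≤ hU U t := hinf.eventually_ge_atTop _
  have hev2 : ∀ᶠ t in nhdsWithin (0:ℝ) (Ioi 0), t < δ / 8 :=
    nhdsWithin_le_nhds (gt_mem_nhds (by positivity))
  filter_upwards [hev1, hev2, self_mem_nhdsWithin] with t h1 h2 h3
  have ht : 0 < t := h3
  have hut := hpos t ht (by linarith)
  have hii : ∀ a b, 0 < a → a ≤ b → IntervalIntegrable (fun x => U x / x^2) volume a b := by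
    intro a b ha hab
    apply ContinuousOn.intervalIntegrable
    rw [uIcc_of_le hab]
    refine (hc.continuousOn.div (by fun_prop) ?_)
    intro s hs
    have : 0 < s := by linarith [hs.1]
    positivity
  have hMt : M * t ≤ ε * U t := by
    have T := L.tail ht (by linarith : t ≤ δ) le_rfl
    have := intervalIntegral.integral_add_adjacent_intervals (hii t δ ht (by linarith)) (hii δ Real.pi d0 d1.le)
    unfold hU at h1
    have h4 : M / ε ≤ U t / t := by
      rw [mul_div_assoc] at T
      linarith
    rw [div_le_div_iff₀ e0 ht] at h4
    linarith
  have I2c : |∫ x in (δ/4)..Real.pi, (U (x + t) - U (x - t)) / Real.tan (x / 2)| ≤ M * t := by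
    have hb1 : ∀ x ∈ uIoc (δ/4) Real.pi, ‖(U (x + t) - U (x - t)) / Real.tan (x / 2)‖ ≤ C * t * (8 / δ) := by
      intro x hx
      rw [uIoc_of_le (by linarith)] at hx
      have hx1 := hx.1
      have xp : 0 < x := by linarith
      obtain ⟨c0, c1⟩ := cotb xp hx.2
      rw [div_eq_mul_one_div, norm_mul, Real.norm_eq_abs, Real.norm_eq_abs, abs_of_nonneg c0]
      refine mul_le_mul (hC t x ht (by linarith) hx.1.le hx.2) (c1.trans ?_) c0 (by positivity)
      rw [div_le_div_iff₀ xp d0]; linarith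
    have := intervalIntegral.norm_integral_le_of_norm_le_const hb1
    rw [Real.norm_eq_abs, abs_of_nonneg (show 0 ≤ Real.pi - δ/4 by linarith)] at this
    refine this.trans ?_
    calc _ ≤ C * t * (8/δ) * Real.pi := by gcongr; linarith
      _ = _ := by rw [hM]; ring
  have A1 := L.I1 ht (by linarith)
  have A2 := L.I2a ht (by linarith)
  have A3 := L.I2b ht (by linarith)
  have hcf : Continuous (fun x => U (x + t) - U (x - t)) := by fun_prop
  have s1 := intervalIntegral.integral_add_adjacent_intervals
    (tan_cont hcf ht (by linarith : t ≤ 2*t) (by linarith))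
    (tan_cont hcf (by linarith) (by linarith : 2*t ≤ δ/4) (by linarith))
  have s2 := intervalIntegral.integral_add_adjacent_intervals
    (tan_cont hcf ht (by linarith : t ≤ δ/4) (by linarith))
    (tan_cont hcf (by linarith) (by linarith : δ/4 ≤ Real.pi) le_rfl)
  rw [dist_zero_right, Real.norm_eq_abs, abs_div, abs_of_pos hut, div_lt_iff₀ hut]
  unfold conjFun
  rw [← s2, ← s1, ← mul_sub, abs_mul]
  have q0 : |1 / (2 * Real.pi)| ≤ 1 := by
    rw [abs_of_pos (by positivity), div_le_one (by positivity)]; linarith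
  generalize (∫ x in (0 : ℝ)..t, (U (t - x) - U (t + x)) / Real.tan (x / 2)) = J1 at *
  generalize (∫ x in t..(2*t), (U (x + t) - U (x - t)) / Real.tan (x / 2)) = J2 at *
  generalize (∫ x in (2*t)..(δ/4), (U (x + t) - U (x - t)) / Real.tan (x / 2)) = J3 at *
  generalize (∫ x in (δ/4)..Real.pi, (U (x + t) - U (x - t)) / Real.tan (x / 2)) = J4 at *
  have B : |J1 - (J2 + J3 + J4)| ≤ 91 * (ε * U t) := by
    rw [abs_le] at *
    constructor <;> linarith [A1.1, A1.2, A2.1, A2.2, A3.1, A3.2, I2c.1, I2c.2]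
  have B2 : ε * U t ≤ r / 182 * U t := by gcongr
  have : 0 < r * U t := by positivity
  calc _ ≤ 1 * |J1 - (J2 + J3 + J4)| := by gcongr
    _ < r * U t := by linarith

end
end
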